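/- Let q > 1/2 and ε ∈ (0,1). There exist a full density subset S ⊆ 𝒩 and a function δ : S → ℝ with δ(m) → 0 as m → ∞ (m ∈ S), such that for every m ∈ S and every real G with 2 ≤ G ≤ m^{1−ε}, one has Σ_{n∈𝒩, |m−n|≥G} |m − n|^{−2q} ≤ (log G)² · G^{1−2q} · (log m)^{−1/2 + δ(m)}. -/

import Mathlib

open Filter Topology

noncomputable section

/-- The set of natural numbers expressible as a sum of two squares. -/
def SOS : Set ℕ := {n | ∃ x y : ℤ, (n : ℤ) = x ^ 2 + y ^ 2}

/-- A subset `S ⊆ 𝒩` has full density in `𝒩`. -/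
def FullDensityIn (S : Set ℕ) : Prop :=
  S ⊆ SOS ∧ Tendsto (fun x : ℕ =>
    (Nat.card {m : ℕ // m ∈ S ∧ m ≤ x} : ℝ) / (Nat.card {m : ℕ // m ∈ SOS ∧ m ≤ x} : ℝ))
    atTop (𝓝 1)

theorem abs_sum_range_mul_le_of_antitone (a f : ℕ → ℝ) (B : ℝ)
    (hS : ∀ n, |∑ i ∈ Finset.range n, a i| ≤ B) (hf : Antitone f) (hf0 : ∀ n, 0 ≤ f n) (n : ℕ) :
    |∑ i ∈ Finset.range n, a i * f i| ≤ B * f 0 := by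
  have key : ∀ n, ∑ i ∈ Finset.range n, a i * f i = (∑ i ∈ Finset.range n, a i) * f n +
      ∑ i ∈ Finset.range n, (∑ j ∈ Finset.range (i + 1), a j) * (f i - f (i + 1)) := by
    intro n
    induction n with
    | zero => simp
    | succ n ih =>
      rw [Finset.sum_range_succ, ih, Finset.sum_range_succ (f := fun i =>
        (∑ j ∈ Finset.range (i + 1), a j) * (f i - f (i + 1)))]
      rw [Finset.sum_range_succ (f := a)]
      ring
  have tele : ∑ i ∈ Finset.range n, (f i - f (i + 1)) = f 0 - f n := Finset.sum_range_sub' f n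
  rw [key]
  calc _ ≤ |(∑ i ∈ Finset.range n, a i) * f n| +
      |∑ i ∈ Finset.range n, (∑ j ∈ Finset.range (i + 1), a j) * (f i - f (i + 1))| :=
        abs_add_le _ _
    _ ≤ B * f n + ∑ i ∈ Finset.range n, B * (f i - f (i + 1)) := by
        gcongr
        · rw [abs_mul, abs_of_nonneg (hf0 n)]
          exact mul_le_mul_of_nonneg_right (hS n) (hf0 n)
        · refine (Finset.abs_sum_le_sum_abs _ _).trans (Finset.sum_le_sum fun i _ => ?_)
          have h0 : 0 ≤ f i - f (i + 1) := sub_nonneg.2 (hf (Nat.le_succ i))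
          rw [abs_mul, abs_of_nonneg h0]
          exact mul_le_mul_of_nonneg_right (hS _) h0
    _ = B * f 0 := by rw [← Finset.mul_sum, tele]; ring

theorem abs_sum_Ico_mul_le_of_antitoneOn (a f : ℕ → ℝ) (B : ℝ) (M : ℕ)
    (hS : ∀ n, |∑ i ∈ Finset.Ico M n, a i| ≤ B) (hf : AntitoneOn f (Set.Ici M))
    (hf0 : ∀ n, M ≤ n → 0 ≤ f n) (N : ℕ) :
    |∑ i ∈ Finset.Ico M N, a i * f i| ≤ B * f M := by
  rw [Finset.sum_Ico_eq_sum_range]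
  refine abs_sum_range_mul_le_of_antitone (fun i => a (M + i)) (fun i => f (M + i)) B ?_ ?_ ?_ _
  · intro n
    have := hS (M + n)
    rwa [Finset.sum_Ico_eq_sum_range, Nat.add_sub_cancel_left] at this
  · intro i j hij
    exact hf (by simp) (by simp) (by simpa using hij)
  · intro n
    exact hf0 _ (by simp)

/-- The nontrivial real character modulo 4. -/
def chi (n : ℕ) : ℝ := ((ZMod.χ₄ (n : ZMod 4) : ℤ) : ℝ)

theorem chi_mul (m n : ℕ) : chi (m * n) = chi m * chi n := by
  rw [chi, chi, chi, Nat.cast_mul, map_mul, Int.cast_mul]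

theorem chi_eq (n : ℕ) : chi n = if n % 4 = 1 then 1 else if n % 4 = 3 then -1 else 0 := by
  rw [chi, ZMod.χ₄_nat_eq_if_mod_four]
  have : n % 4 < 4 := Nat.mod_lt _ (by norm_num)
  split_ifs <;> first | omega | norm_num

theorem abs_chi_le (n : ℕ) : |chi n| ≤ 1 := by
  rw [chi_eq]; split_ifs <;> norm_num

theorem sum_range_chi (n : ℕ) :
    ∑ i ∈ Finset.range n, chi i = if n % 4 = 2 ∨ n % 4 = 3 then 1 else 0 := by
  induction n with
  | zero => simp
  | succ n ih =>
    rw [Finset.sum_range_succ, ih, chi_eq]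
    have : n % 4 < 4 := Nat.mod_lt _ (by norm_num)
    split_ifs <;> first | omega | norm_num

theorem abs_sum_Ico_chi_le (m n : ℕ) : |∑ i ∈ Finset.Ico m n, chi i| ≤ 1 := by
  rcases le_total m n with h | h
  · rw [Finset.sum_Ico_eq_sub _ h, sum_range_chi, sum_range_chi]
    split_ifs <;> norm_num
  · simp [Finset.Ico_eq_empty_of_le h]

theorem abs_sum_chi_mul_log_div_le (N : ℕ) :
    |∑ n ∈ Finset.Ioc 0 N, chi n * (Real.log n / n)| ≤ Real.log 3 / 3 := by
  have h : ∑ n ∈ Finset.Ioc 0 N, chi n * (Real.log n / n) =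
      ∑ n ∈ Finset.Ico 3 (N + 1), chi n * (Real.log n / n) := by
    symm
    apply Finset.sum_subset
    · intro n hn
      simp only [Finset.mem_Ico, Finset.mem_Ioc] at *
      omega
    · intro n hn hn'
      simp only [Finset.mem_Ico, Finset.mem_Ioc] at *
      have : n = 1 ∨ n = 2 := by omega
      rcases this with rfl | rfl
      · simp
      · simp [chi_eq]
  rw [h]
  have := abs_sum_Ico_mul_le_of_antitoneOn chi (fun n => Real.log n / n) 1 3
    (abs_sum_Ico_chi_le 3) ?_ ?_ (N + 1)
  · simpa using this
  · intro i hi j hj hij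
    simp only [Set.mem_Ici] at hi hj
    have he : Real.exp 1 ≤ 3 := by linarith [Real.exp_one_lt_d9]
    have hi' : (3 : ℝ) ≤ i := by exact_mod_cast hi
    have hj' : (3 : ℝ) ≤ j := by exact_mod_cast hj
    exact Real.log_div_self_antitoneOn (he.trans hi') (he.trans hj') (by exact_mod_cast hij)
  · intro n hn
    positivity

theorem exists_sum_chi_div_approx :
    ∃ L : ℝ, 0 < L ∧ ∀ K : ℕ, |∑ k ∈ Finset.Ioc 0 K, chi k / k - L| ≤ 1 / (K + 1) := by
  set F : ℕ → ℝ := fun K => ∑ k ∈ Finset.Ioc 0 K, chi k / k with hF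
  have hdiff : ∀ K K', K ≤ K' → |F K' - F K| ≤ 1 / (K + 1) := by
    intro K K' hK
    have h1 : F K' - F K = ∑ n ∈ Finset.Ico (K + 1) (K' + 1), chi n * (1 / (n : ℝ)) := by
      have e : Finset.Ico (K + 1) (K' + 1) = Finset.Ioc K K' := by
        ext; simp only [Finset.mem_Ico, Finset.mem_Ioc]; omega
      rw [e, sub_eq_iff_eq_add', hF]
      simp only [mul_one_div]
      exact (Finset.sum_Ioc_consecutive _ (Nat.zero_le K) hK).symm
    rw [h1]
    have := abs_sum_Ico_mul_le_of_antitoneOn chi (fun n => 1 / (n : ℝ)) 1 (K + 1)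
      (abs_sum_Ico_chi_le _) ?_ ?_ (K' + 1)
    · simpa using this
    · intro i hi j hj hij
      simp only [Set.mem_Ici] at hi hj
      have : (0 : ℝ) < i := by exact_mod_cast (by omega : 0 < i)
      have : (i : ℝ) ≤ j := by exact_mod_cast hij
      simp only
      gcongr
    · intro n _
      positivity
  have hc : CauchySeq F := by
    refine cauchySeq_of_le_tendsto_0 (fun K : ℕ => 2 / ((K : ℝ) + 1)) ?_ ?_
    · intro n m N hn hm
      rw [Real.dist_eq]
      have e : F n - F m = (F n - F N) - (F m - F N) := by ring
      rw [e]
      refine (abs_sub _ _).trans ?_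
      have := hdiff N n hn
      have := hdiff N m hm
      have e2 : 2 / ((N : ℝ) + 1) = 1 / (N + 1) + 1 / (N + 1) := by ring
      rw [e2]; linarith
    · have := (tendsto_one_div_add_atTop_nhds_zero_nat (𝕜 := ℝ)).const_mul 2
      simpa [div_eq_mul_inv] using this
  obtain ⟨L, hL⟩ := cauchySeq_tendsto_of_complete hc
  have hb : ∀ K : ℕ, |F K - L| ≤ 1 / (K + 1) := by
    intro K
    have ht : Tendsto (fun K' => |F K - F K'|) atTop (𝓝 |F K - L|) :=
      (tendsto_const_nhds.sub hL).abs
    refine le_of_tendsto ht ?_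
    filter_upwards [eventually_ge_atTop K] with K' hK'
    rw [abs_sub_comm]
    exact hdiff K K' hK'
  refine ⟨L, ?_, hb⟩
  have h3 := hb 3
  have e3 : F 3 = 2 / 3 := by
    have : Finset.Ioc 0 3 = {1, 2, 3} := by decide
    rw [hF]; simp only [this]
    norm_num [chi_eq]
  rw [e3, abs_le] at h3
  norm_num at h3
  linarith [h3.2]

open ArithmeticFunction in
theorem sum_vonMangoldt_le (N : ℕ) :
    ∑ n ∈ Finset.Ioc 0 N, vonMangoldt n ≤ (Real.log 4 + 4) * N := by
  have := Chebyshev.psi_le_const_mul_self (x := (N : ℝ)) (Nat.cast_nonneg N)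
  simpa [Chebyshev.psi] using this

/-- Summation of `g n * log n` over `n ≤ N` for completely multiplicative `g`. -/
theorem sum_mul_log_eq_sum_vonMangoldt (g : ℕ → ℝ) (hg : ∀ m n, g (m * n) = g m * g n) (N : ℕ) :
    ∑ n ∈ Finset.Ioc 0 N, g n * Real.log n =
      ∑ d ∈ Finset.Ioc 0 N, g d * ArithmeticFunction.vonMangoldt d *
        ∑ k ∈ Finset.Ioc 0 (N / d), g k := by
  let a : ArithmeticFunction ℝ :=
    ⟨fun n => if n = 0 then 0 else g n * ArithmeticFunction.vonMangoldt n, by simp⟩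
  let b : ArithmeticFunction ℝ := ⟨fun n => if n = 0 then 0 else g n, by simp⟩
  have h := ArithmeticFunction.sum_Ioc_mul_eq_sum_sum a b N
  have ha : ∀ n, n ≠ 0 → a n = g n * ArithmeticFunction.vonMangoldt n := by
    intro n hn; simp [a, hn]
  have hb : ∀ n, n ≠ 0 → b n = g n := by
    intro n hn; simp [b, hn]
  have hab : ∀ n ∈ Finset.Ioc 0 N, (a * b) n = g n * Real.log n := by
    intro n hn
    have hn0 : n ≠ 0 := by simp at hn; omega
    rw [ArithmeticFunction.mul_apply, ← ArithmeticFunction.vonMangoldt_sum, Finset.mul_sum]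
    refine Eq.trans ?_ (Nat.sum_divisorsAntidiagonal
      (f := fun i _ => g n * ArithmeticFunction.vonMangoldt i))
    refine Finset.sum_congr rfl fun x hx => ?_
    obtain ⟨hx1, -⟩ := Nat.mem_divisorsAntidiagonal.1 hx
    have h1 : x.1 ≠ 0 := by rintro h; simp [h] at hx1; omega
    have h2 : x.2 ≠ 0 := by rintro h; simp [h] at hx1; omega
    rw [ha _ h1, hb _ h2, ← hx1, hg]; ring
  rw [Finset.sum_congr rfl hab] at h
  rw [h]
  refine Finset.sum_congr rfl fun d hd => ?_
  have hd0 : d ≠ 0 := by simp at hd; omega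
  rw [ha d hd0]
  congr 1
  refine Finset.sum_congr rfl fun k hk => ?_
  exact hb k (by simp at hk; omega)

theorem sum_log_eq_log_factorial (N : ℕ) :
    ∑ n ∈ Finset.Ioc 0 N, Real.log n = Real.log (N.factorial) := by
  induction N with
  | zero => simp
  | succ N ih =>
    rw [Finset.sum_Ioc_succ_top (Nat.zero_le N), ih, Nat.factorial_succ, Nat.cast_mul,
      Real.log_mul (by positivity) (by positivity), add_comm]

theorem abs_sum_vonMangoldt_div_sub_log_le (N : ℕ) (hN : 1 ≤ N) :
    |∑ n ∈ Finset.Ioc 0 N, ArithmeticFunction.vonMangoldt n / n - Real.log N| ≤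
      Real.log 4 + 4 := by
  have hN0 : (0 : ℝ) < N := by exact_mod_cast hN
  have h := sum_mul_log_eq_sum_vonMangoldt (fun _ => 1) (by simp) N
  simp only [one_mul, Finset.sum_const, Nat.card_Ioc, nsmul_eq_mul, mul_one, tsub_zero] at h
  rw [sum_log_eq_log_factorial] at h
  have hup : Real.log N.factorial ≤ N * Real.log N := by
    rw [← Real.log_pow]
    apply Real.log_le_log (by positivity)
    exact_mod_cast Nat.factorial_le_pow N
  have hlo : N * Real.log N - N ≤ Real.log N.factorial := by
    have := Stirling.le_log_factorial_stirling (n := N) (by omega)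
    have h1 : 0 ≤ Real.log N := Real.log_nonneg (by exact_mod_cast hN)
    have h2 : 0 ≤ Real.log (2 * Real.pi) := Real.log_nonneg (by linarith [Real.pi_gt_three])
    linarith
  have hpsi := sum_vonMangoldt_le N
  have hS1 : ∑ d ∈ Finset.Ioc 0 N, ArithmeticFunction.vonMangoldt d * ((N / d : ℕ) : ℝ) ≤
      N * ∑ n ∈ Finset.Ioc 0 N, ArithmeticFunction.vonMangoldt n / n := by
    rw [Finset.mul_sum]
    refine Finset.sum_le_sum fun d hd => ?_
    have : ((N / d : ℕ) : ℝ) ≤ N / d := Nat.cast_div_le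
    calc _ ≤ ArithmeticFunction.vonMangoldt d * ((N : ℝ) / d) :=
          mul_le_mul_of_nonneg_left this ArithmeticFunction.vonMangoldt_nonneg
      _ = _ := by ring
  have hS2 : N * ∑ n ∈ Finset.Ioc 0 N, ArithmeticFunction.vonMangoldt n / n ≤
      ∑ d ∈ Finset.Ioc 0 N, ArithmeticFunction.vonMangoldt d * ((N / d : ℕ) : ℝ) +
      ∑ d ∈ Finset.Ioc 0 N, ArithmeticFunction.vonMangoldt d := by
    rw [Finset.mul_sum, ← Finset.sum_add_distrib]
    refine Finset.sum_le_sum fun d hd => ?_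
    have hd0 : 0 < d := by simp at hd; omega
    have : (N : ℝ) / d ≤ ((N / d : ℕ) : ℝ) + 1 := by
      rw [← Nat.floor_div_eq_div (K := ℝ)]
      exact (Nat.lt_floor_add_one _).le
    calc _ = ArithmeticFunction.vonMangoldt d * ((N : ℝ) / d) := by ring
      _ ≤ ArithmeticFunction.vonMangoldt d * (((N / d : ℕ) : ℝ) + 1) :=
          mul_le_mul_of_nonneg_left this ArithmeticFunction.vonMangoldt_nonneg
      _ = _ := by ring
  have hl4 : 0 ≤ Real.log 4 := Real.log_nonneg (by norm_num)
  set A := ∑ n ∈ Finset.Ioc 0 N, ArithmeticFunction.vonMangoldt n / n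
  rw [abs_le]
  constructor
  · have : N * (Real.log N - 1) ≤ N * A := by linarith
    have := le_of_mul_le_mul_left this hN0
    linarith
  · have : N * A ≤ N * (Real.log N + (Real.log 4 + 4)) := by linarith
    have := le_of_mul_le_mul_left this hN0
    linarith

theorem exists_abs_sum_chi_vonMangoldt_div_le :
    ∃ C : ℝ, ∀ N : ℕ, |∑ n ∈ Finset.Ioc 0 N, chi n * (ArithmeticFunction.vonMangoldt n / n)| ≤
      C := by
  obtain ⟨L, hL, hK⟩ := exists_sum_chi_div_approx
  refine ⟨(Real.log 3 / 3 + (Real.log 4 + 4)) / L, fun N => ?_⟩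
  have hl4 : 0 ≤ Real.log 4 := Real.log_nonneg (by norm_num)
  have hl3 : 0 ≤ Real.log 3 := Real.log_nonneg (by norm_num)
  rcases Nat.eq_zero_or_pos N with rfl | hN
  · simp; positivity
  have hN0 : (0 : ℝ) < N := by exact_mod_cast hN
  have h := sum_mul_log_eq_sum_vonMangoldt (fun n => chi n / n)
    (by intro m n; rw [chi_mul]; push_cast; rw [mul_div_mul_comm]) N
  set S := ∑ n ∈ Finset.Ioc 0 N, chi n * (ArithmeticFunction.vonMangoldt n / n) with hS
  have h1 : |∑ n ∈ Finset.Ioc 0 N, chi n / n * Real.log n| ≤ Real.log 3 / 3 := by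
    refine le_trans (le_of_eq ?_) (abs_sum_chi_mul_log_div_le N)
    congr 1
    exact Finset.sum_congr rfl fun n _ => by ring
  have h2 : |∑ n ∈ Finset.Ioc 0 N, chi n / n * Real.log n - L * S| ≤ Real.log 4 + 4 := by
    rw [h, hS, Finset.mul_sum, ← Finset.sum_sub_distrib]
    refine (Finset.abs_sum_le_sum_abs _ _).trans ?_
    have : ∀ d ∈ Finset.Ioc 0 N, |chi d / d * ArithmeticFunction.vonMangoldt d *
        ∑ k ∈ Finset.Ioc 0 (N / d), chi k / k - L * (chi d *
          (ArithmeticFunction.vonMangoldt d / d))| ≤ ArithmeticFunction.vonMangoldt d / N := by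
      intro d hd
      have hd0 : (0 : ℝ) < d := by simp at hd; exact_mod_cast hd.1
      have hV : 0 ≤ ArithmeticFunction.vonMangoldt d := ArithmeticFunction.vonMangoldt_nonneg
      have e : chi d / d * ArithmeticFunction.vonMangoldt d *
        ∑ k ∈ Finset.Ioc 0 (N / d), chi k / k - L * (chi d *
          (ArithmeticFunction.vonMangoldt d / d)) = chi d * ((ArithmeticFunction.vonMangoldt d / d) *
          (∑ k ∈ Finset.Ioc 0 (N / d), chi k / k - L)) := by ring
      rw [e, abs_mul, abs_mul, abs_of_nonneg (div_nonneg hV hd0.le)]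
      have h3 : (N : ℝ) / d ≤ ((N / d : ℕ) : ℝ) + 1 := by
        rw [← Nat.floor_div_eq_div (K := ℝ)]
        exact (Nat.lt_floor_add_one _).le
      have h4 : 1 / (((N / d : ℕ) : ℝ) + 1) ≤ d / N := by
        rw [← one_div_div (N : ℝ)]
        exact one_div_le_one_div_of_le (by positivity) h3
      calc _ ≤ 1 * ((ArithmeticFunction.vonMangoldt d / d) * (d / N)) := by
            gcongr
            · exact abs_chi_le d
            · exact (hK _).trans h4
        _ = _ := by field_simp
    refine (Finset.sum_le_sum this).trans ?_
    rw [← Finset.sum_div, div_le_iff₀ hN0]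
    exact sum_vonMangoldt_le N
  rw [le_div_iff₀ hL]
  have : |L * S| ≤ Real.log 3 / 3 + (Real.log 4 + 4) := by
    rw [abs_le] at *
    constructor <;> linarith [h1.1, h1.2, h2.1, h2.2]
  rwa [abs_mul, abs_of_pos hL, mul_comm] at this

theorem exists_sum_vonMangoldt_not_prime_div_le :
    ∃ C : ℝ, ∀ N : ℕ, ∑ n ∈ Finset.Ioc 0 N,
      (if n.Prime then 0 else ArithmeticFunction.vonMangoldt n) / n ≤ C := by
  have h := ArithmeticFunction.vonMangoldt.summable_residueClass_non_primes_div (0 : ZMod 1)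
  have e : (fun n : ℕ => (if n.Prime then 0 else
      ArithmeticFunction.vonMangoldt.residueClass (0 : ZMod 1) n) / (n : ℝ)) =
      fun n : ℕ => (if n.Prime then 0 else ArithmeticFunction.vonMangoldt n) / (n : ℝ) := by
    ext n
    have : ArithmeticFunction.vonMangoldt.residueClass (0 : ZMod 1) n =
        ArithmeticFunction.vonMangoldt n := by
      apply Set.indicator_of_mem
      exact Subsingleton.elim _ _
    rw [this]
  rw [e] at h
  refine ⟨_, fun N => h.sum_le_tsum _ fun n _ => ?_⟩
  have := ArithmeticFunction.vonMangoldt_nonneg (n := n)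
  split_ifs <;> positivity

theorem exists_abs_sum_prime_log_div_sub_le (a : ℕ) (ha : a = 1 ∨ a = 3) :
    ∃ C : ℝ, ∀ N : ℕ, 1 ≤ N → |∑ n ∈ Finset.Ioc 0 N,
      (if n.Prime ∧ n % 4 = a then Real.log n / n else 0) - Real.log N / 2| ≤ C := by
  obtain ⟨C2, hC2⟩ := exists_abs_sum_chi_vonMangoldt_div_le
  obtain ⟨C3, hC3⟩ := exists_sum_vonMangoldt_not_prime_div_le
  obtain ⟨s, hs, hsa⟩ : ∃ s : ℝ, |s| = 1 ∧ ∀ n : ℕ, n % 2 = 1 →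
      (1 + s * chi n) / 2 = if n % 4 = a then 1 else 0 := by
    rcases ha with rfl | rfl
    · refine ⟨1, by simp, fun n hn => ?_⟩
      rw [chi_eq]; split_ifs <;> first | omega | norm_num
    · refine ⟨-1, by simp, fun n hn => ?_⟩
      rw [chi_eq]; split_ifs <;> first | omega | norm_num
  refine ⟨(Real.log 4 + 4) / 2 + C2 / 2 + C3 + Real.log 2, fun N hN => ?_⟩
  have h1 := abs_sum_vonMangoldt_div_sub_log_le N hN
  have h2 := hC2 N
  have h3 := hC3 N
  set V : ℕ → ℝ := fun n => ArithmeticFunction.vonMangoldt n with hV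
  have hV0 : ∀ n, 0 ≤ V n := fun n => ArithmeticFunction.vonMangoldt_nonneg
  have hid : ∀ n ∈ Finset.Ioc 0 N, |(if n.Prime ∧ n % 4 = a then Real.log n / n else 0) -
      (1 / 2 * (V n / n) + s / 2 * (chi n * (V n / n)))| ≤
      (if n.Prime then 0 else V n) / n + (if n = 2 then Real.log 2 else 0) := by
    intro n hn
    have hn0 : (0 : ℝ) < n := by simp at hn; exact_mod_cast hn.1
    have e : 1 / 2 * (V n / n) + s / 2 * (chi n * (V n / n)) =
        (1 + s * chi n) / 2 * (V n / n) := by ring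
    rw [e]
    have hc : |(1 + s * chi n) / 2| ≤ 1 := by
      have : |s * chi n| ≤ 1 := by rw [abs_mul, hs, one_mul]; exact abs_chi_le n
      rw [abs_le] at *
      constructor <;> linarith [this.1, this.2]
    by_cases hp : n.Prime
    · have hVn : V n = Real.log n := ArithmeticFunction.vonMangoldt_apply_prime hp
      rcases hp.eq_two_or_odd with h2 | hodd
      · subst h2
        have : ¬ (2 % 4 = a) := by omega
        simp only [this, and_false, if_false, hp, if_true, zero_sub, abs_neg, zero_div, zero_add]
        rw [abs_mul, hVn]
        have hl : 0 ≤ Real.log 2 := Real.log_nonneg (by norm_num)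
        push_cast
        rw [abs_of_nonneg (by positivity : 0 ≤ Real.log 2 / 2)]
        nlinarith [mul_le_mul_of_nonneg_right hc (by positivity : 0 ≤ Real.log 2 / 2)]
      · rw [hsa n hodd, hVn]
        have : n ≠ 2 := by omega
        by_cases h4 : n % 4 = a <;> simp [hp, h4, this]
    · have : n ≠ 2 := by rintro rfl; exact hp Nat.prime_two
      simp only [hp, false_and, if_false, this, zero_sub, abs_neg, add_zero]
      rw [abs_mul, abs_of_nonneg (div_nonneg (hV0 n) hn0.le)]
      exact mul_le_of_le_one_left (div_nonneg (hV0 n) hn0.le) hc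
  have hsum := (Finset.abs_sum_le_sum_abs _ _).trans (Finset.sum_le_sum hid)
  rw [Finset.sum_sub_distrib, Finset.sum_add_distrib, Finset.sum_add_distrib, ← Finset.mul_sum,
    ← Finset.mul_sum] at hsum
  have h5 : ∑ n ∈ Finset.Ioc 0 N, (if n = 2 then Real.log 2 else 0) ≤ Real.log 2 := by
    rw [Finset.sum_ite_eq']
    split_ifs
    · exact le_rfl
    · exact Real.log_nonneg (by norm_num)
  have h6 : |s / 2 * ∑ n ∈ Finset.Ioc 0 N, chi n * (V n / n)| ≤ C2 / 2 := by
    rw [abs_mul, abs_div, hs, abs_two]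
    linarith
  rw [abs_le] at *
  constructor <;> linarith [hsum.1, hsum.2, h1.1, h1.2, h6.1, h6.2]

theorem exists_prime_one_mod_four_count :
    ∃ K : ℕ, 1 ≤ K ∧ ∀ Z : ℕ, 1 ≤ Z → (Z : ℝ) ≤ Real.log (K * Z) *
      ((Finset.Ioc Z (K * Z)).filter (fun p => p.Prime ∧ p % 4 = 1)).card := by
  obtain ⟨C, hC⟩ := exists_abs_sum_prime_log_div_sub_le 1 (Or.inl rfl)
  obtain ⟨K, hK⟩ := exists_nat_ge (Real.exp (4 * C + 2))
  have hKpos : 0 < K := by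
    have : (0 : ℝ) < K := (Real.exp_pos _).trans_le hK
    exact_mod_cast this
  refine ⟨K, hKpos, fun Z hZ => ?_⟩
  have hZ0 : (0 : ℝ) < Z := by exact_mod_cast hZ
  have hK0 : (0 : ℝ) < K := by exact_mod_cast hKpos
  have hle : Z ≤ K * Z := Nat.le_mul_of_pos_left Z hKpos
  have h1 := hC Z hZ
  have h2 := hC (K * Z) (hZ.trans hle)
  rw [← Finset.sum_Ioc_consecutive _ (Nat.zero_le Z) hle] at h2
  have hlog : Real.log ((K * Z : ℕ) : ℝ) = Real.log K + Real.log Z := by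
    push_cast; rw [Real.log_mul (by positivity) (by positivity)]
  have hlK : 4 * C + 2 ≤ Real.log K := by
    rw [Real.le_log_iff_exp_le hK0]; exact hK
  rw [hlog] at h2
  have h3 : 1 ≤ ∑ n ∈ Finset.Ioc Z (K * Z),
      (if n.Prime ∧ n % 4 = 1 then Real.log n / n else 0) := by
    rw [abs_le] at h1 h2
    linarith [h1.1, h1.2, h2.1, h2.2]
  have h4 : ∑ n ∈ Finset.Ioc Z (K * Z), (if n.Prime ∧ n % 4 = 1 then Real.log n / n else 0) ≤
      ((Finset.Ioc Z (K * Z)).filter (fun p => p.Prime ∧ p % 4 = 1)).card *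
        (Real.log (K * Z) / Z) := by
    rw [← Finset.sum_filter, ← nsmul_eq_mul]
    refine Finset.sum_le_card_nsmul _ _ _ fun n hn => ?_
    simp only [Finset.mem_filter, Finset.mem_Ioc] at hn
    have hn1 : (Z : ℝ) ≤ n := by exact_mod_cast hn.1.1.le
    have hn2 : (n : ℝ) ≤ K * Z := by exact_mod_cast hn.1.2
    have hn3 : (1 : ℝ) ≤ n := by exact_mod_cast hn.2.1.one_le
    have := Real.log_nonneg hn3
    exact div_le_div₀ (Real.log_nonneg (hn3.trans hn2)) (Real.log_le_log (by linarith) hn2) hZ0 hn1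
  have h5 := h3.trans h4
  rw [mul_div_assoc', le_div_iff₀ hZ0] at h5
  linarith

theorem log_log_succ_sub_le (n : ℕ) (hn : 2 ≤ n) :
    Real.log (Real.log (n + 1 : ℕ)) - Real.log (Real.log n) ≤ 1 / (n * Real.log n) := by
  have hn0 : (0 : ℝ) < n := by positivity
  have hl : 0 < Real.log n := Real.log_pos (by exact_mod_cast hn)
  have hl' : 0 < Real.log (n + 1 : ℕ) := Real.log_pos (by exact_mod_cast (by omega))
  rw [← Real.log_div hl'.ne' hl.ne']
  refine (Real.log_le_sub_one_of_pos (by positivity)).trans ?_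
  have h1 : Real.log (n + 1 : ℕ) - Real.log n ≤ 1 / n := by
    rw [← Real.log_div (by positivity) (by positivity)]
    refine (Real.log_le_sub_one_of_pos (by positivity)).trans (le_of_eq ?_)
    push_cast; field_simp; ring
  have e : Real.log (n + 1 : ℕ) / Real.log n - 1 =
      (Real.log (n + 1 : ℕ) - Real.log n) / Real.log n := by field_simp
  rw [e, div_le_iff₀ hl]
  refine h1.trans (le_of_eq ?_)
  field_simp

theorem le_log_log_succ_sub (n : ℕ) (hn : 2 ≤ n) :
    1 / (((n + 1 : ℕ) : ℝ) * Real.log (n + 1 : ℕ)) ≤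
      Real.log (Real.log (n + 1 : ℕ)) - Real.log (Real.log n) := by
  have hn0 : (0 : ℝ) < n := by positivity
  have hl : 0 < Real.log n := Real.log_pos (by exact_mod_cast hn)
  have hl' : 0 < Real.log (n + 1 : ℕ) := Real.log_pos (by exact_mod_cast (by omega))
  rw [← Real.log_div hl'.ne' hl.ne']
  have h0 := Real.one_sub_inv_le_log_of_pos (x := Real.log (n + 1 : ℕ) / Real.log n)
    (by positivity)
  refine le_trans ?_ h0
  have h1 : 1 / ((n + 1 : ℕ) : ℝ) ≤ Real.log (n + 1 : ℕ) - Real.log n := by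
    rw [← Real.log_div (by positivity) (by positivity)]
    refine le_trans (le_of_eq ?_) (Real.one_sub_inv_le_log_of_pos (by positivity))
    push_cast; field_simp; ring
  rw [inv_div]
  have e : 1 - Real.log n / Real.log (n + 1 : ℕ) =
      (Real.log (n + 1 : ℕ) - Real.log n) / Real.log (n + 1 : ℕ) := by field_simp
  rw [e, le_div_iff₀ hl']
  refine le_trans (le_of_eq ?_) h1
  field_simp

theorem exists_abs_sum_one_div_mul_log_sub_le :
    ∃ C : ℝ, ∀ N : ℕ, 2 ≤ N → |∑ n ∈ Finset.Ico 2 (N + 1), 1 / (n * Real.log n) -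
      Real.log (Real.log N)| ≤ C := by
  have hlow : ∀ N : ℕ, 2 ≤ N → Real.log (Real.log N) - Real.log (Real.log 2) ≤
      ∑ n ∈ Finset.Ico 2 (N + 1), 1 / (n * Real.log n) := by
    intro N hN
    have : ∀ N : ℕ, 2 ≤ N → Real.log (Real.log N) - Real.log (Real.log 2) ≤
      ∑ n ∈ Finset.Ico 2 N, 1 / (n * Real.log n) := by
      intro N hN
      induction N, hN using Nat.le_induction with
      | base => simp
      | succ N hN ih =>
        rw [Finset.sum_Ico_succ_top hN]
        linarith [log_log_succ_sub_le N hN]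
    refine (this N hN).trans ?_
    rw [Finset.sum_Ico_succ_top hN]
    have : 0 ≤ Real.log N := Real.log_natCast_nonneg N
    have : 0 ≤ 1 / (N * Real.log N) := by positivity
    linarith
  have hup : ∀ N : ℕ, 2 ≤ N → ∑ n ∈ Finset.Ico 2 (N + 1), 1 / (n * Real.log n) ≤
      1 / (2 * Real.log 2) + Real.log (Real.log N) - Real.log (Real.log 2) := by
    intro N hN
    induction N, hN using Nat.le_induction with
    | base => simp
    | succ N hN ih =>
      rw [Finset.sum_Ico_succ_top (by omega)]
      linarith [le_log_log_succ_sub N hN]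
  refine ⟨1 / (2 * Real.log 2) + |Real.log (Real.log 2)|, fun N hN => ?_⟩
  have h1 := hlow N hN
  have h2 := hup N hN
  have h3 : 0 < Real.log 2 := Real.log_pos (by norm_num)
  have h4 : 0 < 1 / (2 * Real.log 2) := by positivity
  have h5 := le_abs_self (Real.log (Real.log 2))
  have h6 := neg_abs_le (Real.log (Real.log 2))
  rw [abs_le]
  constructor <;> linarith

/-- Mertens' second theorem for primes congruent to 3 modulo 4. -/
theorem exists_abs_sum_prime_three_mod_four_inv_sub_le :
    ∃ C : ℝ, ∀ N : ℕ, 2 ≤ N → |∑ p ∈ (Finset.Ioc 0 N).filter (fun p => p.Prime ∧ p % 4 = 3),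
      1 / (p : ℝ) - Real.log (Real.log N) / 2| ≤ C := by
  obtain ⟨C1, h1⟩ := exists_abs_sum_prime_log_div_sub_le 3 (Or.inr rfl)
  obtain ⟨C2, h2⟩ := exists_abs_sum_one_div_mul_log_sub_le
  have hC1 : 0 ≤ C1 := (abs_nonneg _).trans (h1 1 le_rfl)
  set a : ℕ → ℝ := fun n => (if n.Prime ∧ n % 4 = 3 then Real.log n / n else 0) -
    1 / 2 * (1 / n) with ha
  have hharm : ∀ N : ℕ, 1 ≤ N → |∑ n ∈ Finset.Ioc 0 N, 1 / (n : ℝ) - Real.log N| ≤ 1 := by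
    intro N hN
    have e : ∑ n ∈ Finset.Ioc 0 N, 1 / (n : ℝ) = harmonic N := by
      rw [harmonic_eq_sum_Icc]
      push_cast
      simp only [one_div]
      rfl
    rw [e, abs_le]
    have h3 := log_add_one_le_harmonic N
    have h4 := harmonic_le_one_add_log N
    have h5 : Real.log N ≤ Real.log (N + 1 : ℕ) :=
      Real.log_le_log (by exact_mod_cast hN) (by push_cast; linarith)
    constructor <;> linarith
  have hS : ∀ n, |∑ i ∈ Finset.Ico 2 n, a i| ≤ C1 + 1 := by
    intro n
    rcases le_or_gt n 2 with h | h
    · rw [Finset.Ico_eq_empty_of_le h]; simp; linarith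
    · obtain ⟨N, rfl⟩ : ∃ N, n = N + 1 := ⟨n - 1, by omega⟩
      have hN : 1 ≤ N := by omega
      have e : ∑ i ∈ Finset.Ico 2 (N + 1), a i = ∑ i ∈ Finset.Ioc 0 N, a i + 1 / 2 := by
        have e1 : Finset.Ico 2 (N + 1) = Finset.Ioc 1 N := by
          ext; simp only [Finset.mem_Ico, Finset.mem_Ioc]; omega
        rw [e1, ← Finset.sum_Ioc_consecutive a (Nat.zero_le 1) hN]
        simp [ha]
      have e2 : ∑ i ∈ Finset.Ioc 0 N, a i = ∑ n ∈ Finset.Ioc 0 N,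
          (if n.Prime ∧ n % 4 = 3 then Real.log n / n else 0) -
          1 / 2 * ∑ n ∈ Finset.Ioc 0 N, 1 / (n : ℝ) := by
        rw [ha, Finset.sum_sub_distrib, Finset.mul_sum]
      have h3 := hharm N hN
      have h4 := h1 N hN
      rw [e, e2]
      rw [abs_le] at *
      constructor <;> linarith [h3.1, h3.2, h4.1, h4.2]
  refine ⟨(C1 + 1) * (1 / Real.log 2) + C2, fun N hN => ?_⟩
  have h3 := abs_sum_Ico_mul_le_of_antitoneOn a (fun n => 1 / Real.log n) (C1 + 1) 2 hS ?_ ?_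
    (N + 1)
  rotate_left
  · intro i hi j hj hij
    simp only [Set.mem_Ici] at hi hj
    have h5 : 0 < Real.log i := Real.log_pos (by exact_mod_cast hi)
    have h6 : Real.log i ≤ Real.log j :=
      Real.log_le_log (by positivity) (by exact_mod_cast hij)
    exact one_div_le_one_div_of_le h5 h6
  · intro n _
    have := Real.log_natCast_nonneg n
    positivity
  have e : ∑ i ∈ Finset.Ico 2 (N + 1), a i * (1 / Real.log i) =
      ∑ p ∈ (Finset.Ioc 0 N).filter (fun p => p.Prime ∧ p % 4 = 3), 1 / (p : ℝ) -
      1 / 2 * ∑ n ∈ Finset.Ico 2 (N + 1), 1 / (n * Real.log n) := by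
    have e1 : (Finset.Ioc 0 N).filter (fun p => p.Prime ∧ p % 4 = 3) =
        (Finset.Ico 2 (N + 1)).filter (fun p => p.Prime ∧ p % 4 = 3) := by
      ext p
      simp only [Finset.mem_filter, Finset.mem_Ico, Finset.mem_Ioc]
      constructor
      · rintro ⟨h, hp, h'⟩; exact ⟨⟨hp.two_le, by omega⟩, hp, h'⟩
      · rintro ⟨h, hp, h'⟩; exact ⟨⟨hp.pos, by omega⟩, hp, h'⟩
    rw [e1, Finset.sum_filter, Finset.mul_sum, ← Finset.sum_sub_distrib]
    refine Finset.sum_congr rfl fun n hn => ?_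
    simp only [Finset.mem_Ico] at hn
    have h5 : 0 < Real.log n := Real.log_pos (by exact_mod_cast hn.1)
    have h6 : (0 : ℝ) < n := by exact_mod_cast (by omega : 0 < n)
    simp only [ha]
    split_ifs
    · field_simp
    · field_simp; ring
  rw [e] at h3
  have h4 := h2 N hN
  have hC2 : 0 ≤ C2 := (abs_nonneg _).trans h4
  push_cast at h3
  rw [abs_le] at *
  constructor <;> linarith [h3.1, h3.2, h4.1, h4.2]

theorem mem_SOS_iff {n : ℕ} : n ∈ SOS ↔ ∃ x y : ℕ, n = x ^ 2 + y ^ 2 := by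
  constructor
  · rintro ⟨x, y, h⟩
    refine ⟨x.natAbs, y.natAbs, ?_⟩
    zify
    rw [h, sq_abs, sq_abs]
  · rintro ⟨x, y, h⟩
    exact ⟨x, y, by rw [h]; push_cast; ring⟩

theorem mul_mem_SOS {m n : ℕ} (hm : m ∈ SOS) (hn : n ∈ SOS) : m * n ∈ SOS := by
  obtain ⟨x, y, h⟩ := hm
  obtain ⟨u, v, h'⟩ := hn
  exact ⟨x * u - y * v, x * v + y * u, by push_cast; rw [h, h']; ring⟩

theorem prime_mem_SOS {p : ℕ} (hp : p.Prime) (h : p % 4 ≠ 3) : p ∈ SOS := by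
  have := Fact.mk hp
  obtain ⟨a, b, hab⟩ := Nat.Prime.sq_add_sq h
  exact mem_SOS_iff.2 ⟨a, b, hab.symm⟩

theorem sq_mem_SOS (n : ℕ) : n ^ 2 ∈ SOS := mem_SOS_iff.2 ⟨n, 0, by ring⟩

theorem one_mem_SOS : 1 ∈ SOS := mem_SOS_iff.2 ⟨1, 0, by norm_num⟩

theorem sq_dvd_of_mem_SOS {n p : ℕ} (hn : n ∈ SOS) (hp : p.Prime) (h3 : p % 4 = 3) (hd : p ∣ n) :
    p ^ 2 ∣ n := by
  rcases Nat.eq_zero_or_pos n with rfl | hpos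
  · simp
  have := Fact.mk hp
  have := Nat.eq_sq_add_sq_iff.1 (mem_SOS_iff.1 hn) p
    (Nat.mem_primeFactors.2 ⟨hp, hd, hpos.ne'⟩) h3
  rw [padicValNat_dvd_iff_le hpos.ne']
  have h1 : 1 ≤ padicValNat p n := one_le_padicValNat_of_dvd hpos.ne' hd
  obtain ⟨k, hk⟩ := this
  omega

theorem prod_mem_SOS (s : Finset ℕ) (h : ∀ p ∈ s, p ∈ SOS) : ∏ p ∈ s, p ∈ SOS := by
  induction s using Finset.induction_on with
  | empty => simpa using one_mem_SOS
  | insert a s ha ih =>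
    rw [Finset.prod_insert ha]
    exact mul_mem_SOS (h a (by simp)) (ih fun p hp => h p (by simp [hp]))

/-- Every positive integer is a sum of two squares times a product of distinct primes `3 mod 4`. -/
theorem exists_mem_SOS_mul_prod (n : ℕ) (hn : 0 < n) :
    ∃ a ∈ SOS, ∃ T : Finset ℕ, (∀ p ∈ T, p.Prime ∧ p % 4 = 3) ∧ n = a * ∏ p ∈ T, p := by
  obtain ⟨b, a, hb, ha, hab, hsq⟩ := Nat.sq_mul_squarefree_of_pos hn
  refine ⟨a ^ 2 * ∏ p ∈ b.primeFactors.filter (fun p => ¬ p % 4 = 3), p, ?_,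
    b.primeFactors.filter (fun p => p % 4 = 3), ?_, ?_⟩
  · refine mul_mem_SOS (sq_mem_SOS a) (prod_mem_SOS _ fun p hp => ?_)
    simp only [Finset.mem_filter] at hp
    exact prime_mem_SOS (Nat.prime_of_mem_primeFactors hp.1) hp.2
  · intro p hp
    simp only [Finset.mem_filter] at hp
    exact ⟨Nat.prime_of_mem_primeFactors hp.1, hp.2⟩
  · rw [mul_assoc, mul_comm (∏ p ∈ b.primeFactors.filter (fun p => ¬ p % 4 = 3), p),
      Finset.prod_filter_mul_prod_filter_not, Nat.prod_primeFactors_of_squarefree hsq, hab]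

open Classical in
theorem harmonic_le_sum_SOS_inv_mul_prod (Y : ℕ) :
    ∑ n ∈ Finset.Ioc 0 Y, 1 / (n : ℝ) ≤
      (∑ a ∈ (Finset.Ioc 0 Y).filter (· ∈ SOS), 1 / (a : ℝ)) *
      ∏ p ∈ (Finset.Ioc 0 Y).filter (fun p => p.Prime ∧ p % 4 = 3), (1 + 1 / (p : ℝ)) := by
  rw [Finset.prod_one_add, Finset.sum_mul_sum, ← Finset.sum_product']
  have hex : ∀ n : ℕ, ∃ x : ℕ × Finset ℕ, 0 < n → x.1 ∈ SOS ∧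
      (∀ p ∈ x.2, p.Prime ∧ p % 4 = 3) ∧ n = x.1 * ∏ p ∈ x.2, p := by
    intro n
    by_cases hn : 0 < n
    · obtain ⟨a, ha, T, hT, h⟩ := exists_mem_SOS_mul_prod n hn
      exact ⟨(a, T), fun _ => ⟨ha, hT, h⟩⟩
    · exact ⟨(0, ∅), fun h => absurd h hn⟩
  choose g hg using hex
  have hinj : Set.InjOn g (Finset.Ioc 0 Y) := by
    intro m hm n hn hmn
    simp only [Finset.coe_Ioc, Set.mem_Ioc] at hm hn
    rw [(hg m hm.1).2.2, (hg n hn.1).2.2, hmn]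
  calc ∑ n ∈ Finset.Ioc 0 Y, 1 / (n : ℝ)
      = ∑ n ∈ Finset.Ioc 0 Y, 1 / ((g n).1 : ℝ) * ∏ p ∈ (g n).2, 1 / (p : ℝ) := by
        refine Finset.sum_congr rfl fun n hn => ?_
        simp only [Finset.mem_Ioc] at hn
        conv_lhs => rw [(hg n hn.1).2.2]
        push_cast
        rw [Finset.prod_div_distrib]
        simp only [Finset.prod_const_one]
        rw [one_div_mul_one_div]
    _ = ∑ x ∈ (Finset.Ioc 0 Y).image g, 1 / (x.1 : ℝ) * ∏ p ∈ x.2, 1 / (p : ℝ) := by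
        rw [Finset.sum_image hinj]
    _ ≤ _ := by
        refine Finset.sum_le_sum_of_subset_of_nonneg ?_ fun x _ _ => by positivity
        intro x hx
        obtain ⟨n, hn, rfl⟩ := Finset.mem_image.1 hx
        simp only [Finset.mem_Ioc] at hn
        obtain ⟨h1, h2, h3⟩ := hg n hn.1
        have hd1 : (g n).1 ∣ n := ⟨_, h3⟩
        have hd2 : ∀ p ∈ (g n).2, p ∣ n := fun p hp =>
          (Finset.dvd_prod_of_mem _ hp).trans ⟨(g n).1, h3.trans (mul_comm _ _)⟩
        simp only [Finset.mem_product, Finset.mem_filter, Finset.mem_Ioc, Finset.mem_powerset]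
        refine ⟨⟨⟨Nat.pos_of_dvd_of_pos hd1 hn.1, (Nat.le_of_dvd hn.1 hd1).trans hn.2⟩, h1⟩, ?_⟩
        intro p hp
        simp only [Finset.mem_filter, Finset.mem_Ioc]
        exact ⟨⟨(h2 p hp).1.pos, (Nat.le_of_dvd hn.1 (hd2 p hp)).trans hn.2⟩, h2 p hp⟩

open Classical in
theorem exists_sqrt_log_le_sum_SOS_inv :
    ∃ c : ℝ, 0 < c ∧ ∀ Y : ℕ, 2 ≤ Y →
      c * √(Real.log Y) ≤ ∑ a ∈ (Finset.Ioc 0 Y).filter (· ∈ SOS), 1 / (a : ℝ) := by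
  obtain ⟨C, hC⟩ := exists_abs_sum_prime_three_mod_four_inv_sub_le
  refine ⟨Real.exp (-C), Real.exp_pos _, fun Y hY => ?_⟩
  have hl : 0 < Real.log Y := Real.log_pos (by exact_mod_cast hY)
  have h1 := harmonic_le_sum_SOS_inv_mul_prod Y
  set A := ∑ a ∈ (Finset.Ioc 0 Y).filter (· ∈ SOS), 1 / (a : ℝ)
  have hA : 0 ≤ A := Finset.sum_nonneg fun a _ => by positivity
  have h2 : ∏ p ∈ (Finset.Ioc 0 Y).filter (fun p => p.Prime ∧ p % 4 = 3), (1 + 1 / (p : ℝ)) ≤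
      Real.exp C * √(Real.log Y) := by
    calc _ ≤ ∏ p ∈ (Finset.Ioc 0 Y).filter (fun p => p.Prime ∧ p % 4 = 3),
          Real.exp (1 / (p : ℝ)) := by
          refine Finset.prod_le_prod (fun p _ => by positivity) fun p _ => ?_
          rw [add_comm]; exact Real.add_one_le_exp _
      _ = Real.exp (∑ p ∈ (Finset.Ioc 0 Y).filter (fun p => p.Prime ∧ p % 4 = 3),
          1 / (p : ℝ)) := (Real.exp_sum _ _).symm
      _ ≤ Real.exp (C + Real.log (Real.log Y) / 2) := by
          apply Real.exp_le_exp.2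
          have := (abs_le.1 (hC Y hY)).2
          linarith
      _ = _ := by
          rw [Real.exp_add, ← Real.log_sqrt hl.le, Real.exp_log (Real.sqrt_pos.2 hl)]
  have h3 : Real.log Y ≤ ∑ n ∈ Finset.Ioc 0 Y, 1 / (n : ℝ) := by
    have e : ∑ n ∈ Finset.Ioc 0 Y, 1 / (n : ℝ) = harmonic Y := by
      rw [harmonic_eq_sum_Icc]
      push_cast
      simp only [one_div]
      rfl
    rw [e]
    refine le_trans (Real.log_le_log (by positivity) ?_) (log_add_one_le_harmonic Y)
    push_cast; linarith
  have h4 : Real.log Y ≤ A * (Real.exp C * √(Real.log Y)) :=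
    h3.trans (h1.trans (mul_le_mul_of_nonneg_left h2 hA))
  have hs : 0 < √(Real.log Y) := Real.sqrt_pos.2 hl
  have h5 : √(Real.log Y) * √(Real.log Y) ≤ (A * Real.exp C) * √(Real.log Y) := by
    rw [Real.mul_self_sqrt hl.le]; linarith
  have h6 := le_of_mul_le_mul_right h5 hs
  rw [Real.exp_neg, inv_mul_le_iff₀ (Real.exp_pos _)]
  linarith

open Classical in
/-- The number of sums of two squares in `[1, X]`. -/
def countSOS (X : ℕ) : ℕ := ((Finset.Ioc 0 X).filter (· ∈ SOS)).card

open Classical in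
theorem exists_le_countSOS :
    ∃ c : ℝ, 0 < c ∧ ∃ X₀ : ℕ, ∀ X : ℕ, X₀ ≤ X → c * X / √(Real.log X) ≤ countSOS X := by
  obtain ⟨K, hK, hP⟩ := exists_prime_one_mod_four_count
  obtain ⟨c, hc, hA⟩ := exists_sqrt_log_le_sum_SOS_inv
  have hK0 : (0 : ℝ) < K := by exact_mod_cast hK
  refine ⟨c / (4 * K), by positivity, 16 * K ^ 2, fun X hX => ?_⟩
  have hK2 : K ≤ K ^ 2 := Nat.le_self_pow (by norm_num) K
  have hXK : 16 * K ≤ X := by omega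
  set Y := Nat.sqrt (X / K) with hY
  have hYK : K * (Y * Y) ≤ X :=
    (Nat.mul_le_mul_left K (Nat.sqrt_le (X / K))).trans (Nat.mul_div_le X K)
  have hY4 : 4 ≤ Y := by
    rw [hY, Nat.le_sqrt, Nat.le_div_iff_mul_le hK]
    omega
  have hYX : X < K * ((Y + 1) * (Y + 1)) := by
    have h1 := Nat.lt_succ_sqrt (X / K)
    rw [Nat.succ_eq_add_one, ← hY, Nat.div_lt_iff_lt_mul hK] at h1
    rwa [mul_comm K]
  have hYX2 : X ≤ 4 * K * Y ^ 2 := by nlinarith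
  have hY4X : X ≤ Y ^ 4 := by
    have h1 : X * X ≤ (4 * K * Y ^ 2) * (4 * K * Y ^ 2) := Nat.mul_le_mul hYX2 hYX2
    have h2 : X * (16 * K ^ 2) ≤ Y ^ 4 * (16 * K ^ 2) := by
      calc X * (16 * K ^ 2) ≤ X * X := Nat.mul_le_mul_left X hX
        _ ≤ _ := h1
        _ = _ := by ring
    exact Nat.le_of_mul_le_mul_right h2 (by positivity)
  have hX0 : (0 : ℝ) < X := by exact_mod_cast (by omega : 0 < X)
  have hY0 : (0 : ℝ) < Y := by exact_mod_cast (by omega : 0 < Y)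
  have hlX : 0 < Real.log X := Real.log_pos (by exact_mod_cast (by omega : 1 < X))
  have hlY : Real.log X ≤ 4 * Real.log Y := by
    have := Real.log_le_log hX0 (by exact_mod_cast hY4X : (X : ℝ) ≤ (Y : ℝ) ^ 4)
    rwa [Real.log_pow] at this
  set P : ℕ → Finset ℕ := fun m => (Finset.Ioc (X / (K * m)) (K * (X / (K * m)))).filter
    (fun p => p.Prime ∧ p % 4 = 1) with hPdef
  have hZ : ∀ m ∈ Finset.Ioc 0 Y, Y ≤ X / (K * m) := by
    intro m hm
    simp only [Finset.mem_Ioc] at hm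
    rw [Nat.le_div_iff_mul_le (Nat.mul_pos hK hm.1)]
    calc Y * (K * m) = K * (Y * m) := by ring
      _ ≤ K * (Y * Y) := Nat.mul_le_mul_left _ (Nat.mul_le_mul_left _ hm.2)
      _ ≤ X := hYK
  have hcard : ∑ m ∈ (Finset.Ioc 0 Y).filter (· ∈ SOS), (P m).card ≤ countSOS X := by
    rw [← Finset.card_sigma, countSOS]
    refine Finset.card_le_card_of_injOn (fun x => x.1 * x.2) ?_ ?_
    · rintro ⟨m, p⟩ hx
      simp only [Finset.coe_sigma, Set.mem_sigma_iff, Finset.mem_coe, Finset.mem_filter,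
        hPdef, Finset.mem_Ioc] at hx ⊢
      obtain ⟨⟨⟨hm, hmY⟩, hmS⟩, ⟨hp1, hp2⟩, hp, hp4⟩ := hx
      refine ⟨⟨Nat.mul_pos hm hp.pos, ?_⟩, mul_mem_SOS hmS (prime_mem_SOS hp (by omega))⟩
      calc m * p ≤ m * (K * (X / (K * m))) := Nat.mul_le_mul_left m hp2
        _ = (K * m) * (X / (K * m)) := by ring
        _ ≤ X := Nat.mul_div_le _ _
    · rintro ⟨m, p⟩ hx ⟨m', p'⟩ hx' h
      simp only [Finset.coe_sigma, Set.mem_sigma_iff, Finset.mem_coe, Finset.mem_filter,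
        hPdef] at hx hx' h
      obtain ⟨⟨hm, -⟩, hp1, hp, -⟩ := hx
      obtain ⟨⟨hm', -⟩, hp1', hp', -⟩ := hx'
      have h1 := hZ m hm
      have h2 := hZ m' hm'
      simp only [Finset.mem_Ioc] at hm hm' hp1 hp1'
      have hpp : p = p' := by
        have hd : p ∣ m' * p' := ⟨m, by rw [← h, mul_comm]⟩
        rcases hp.dvd_mul.1 hd with hd | hd
        · have := Nat.le_of_dvd hm'.1 hd
          omega
        · exact (Nat.prime_dvd_prime_iff_eq hp hp').1 hd
      subst hpp
      have : m = m' := Nat.eq_of_mul_eq_mul_right hp.pos h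
      subst this
      rfl
  have hterm : ∀ m ∈ (Finset.Ioc 0 Y).filter (· ∈ SOS),
      X / (2 * K) * (1 / (m : ℝ)) ≤ Real.log X * (P m).card := by
    intro m hm
    simp only [Finset.mem_filter] at hm
    have h1 := hZ m hm.1
    have hmm := hm.1
    simp only [Finset.mem_Ioc] at hmm
    have hm0 : (0 : ℝ) < m := by exact_mod_cast hmm.1
    have hZ1 : 1 ≤ X / (K * m) := by omega
    have h2 := hP (X / (K * m)) hZ1
    have h3 : (X : ℝ) < (K * m) * ((X / (K * m) : ℕ) + 1 : ℝ) := by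
      exact_mod_cast Nat.lt_mul_div_succ X (Nat.mul_pos hK hmm.1)
    have hZ1' : (1 : ℝ) ≤ (X / (K * m) : ℕ) := by exact_mod_cast hZ1
    have h4 : Real.log (K * ((X / (K * m) : ℕ) : ℝ)) ≤ Real.log X := by
      apply Real.log_le_log (by positivity)
      have : K * (X / (K * m)) ≤ X := by
        calc K * (X / (K * m)) ≤ (K * (X / (K * m))) * m := Nat.le_mul_of_pos_right _ hmm.1
          _ = (K * m) * (X / (K * m)) := by ring
          _ ≤ X := Nat.mul_div_le _ _
      exact_mod_cast this
    calc X / (2 * K) * (1 / (m : ℝ)) = X / (2 * K * m) := by field_simp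
      _ ≤ (X / (K * m) : ℕ) := by
        rw [div_le_iff₀ (by positivity)]
        nlinarith [mul_pos hK0 hm0]
      _ ≤ _ := h2
      _ ≤ _ := mul_le_mul_of_nonneg_right h4 (Nat.cast_nonneg _)
  have hsum := Finset.sum_le_sum hterm
  rw [← Finset.mul_sum, ← Finset.mul_sum] at hsum
  have hcard' : (∑ m ∈ (Finset.Ioc 0 Y).filter (· ∈ SOS), ((P m).card : ℝ)) ≤ countSOS X := by
    exact_mod_cast hcard
  have hAY := hA Y (by omega)
  have hsq : √(Real.log X) ≤ 2 * √(Real.log Y) := by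
    rw [Real.sqrt_le_left (by positivity), mul_pow, Real.sq_sqrt (by linarith)]
    linarith
  have hs0 : 0 < √(Real.log X) := Real.sqrt_pos.2 hlX
  have h6 : X / (2 * K) * (c * (√(Real.log X) / 2)) ≤ Real.log X * countSOS X := by
    calc _ ≤ X / (2 * K) * (c * √(Real.log Y)) := by gcongr; linarith
      _ ≤ _ := mul_le_mul_of_nonneg_left hAY (by positivity)
      _ ≤ _ := hsum
      _ ≤ _ := mul_le_mul_of_nonneg_left hcard' hlX.le
  rw [div_le_iff₀ hs0]
  have h7 : Real.log X = √(Real.log X) * √(Real.log X) := (Real.mul_self_sqrt hlX.le).symm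
  have h8 : √(Real.log X) * (c / (4 * K) * X) ≤ √(Real.log X) * (countSOS X * √(Real.log X)) := by
    calc _ = X / (2 * K) * (c * (√(Real.log X) / 2)) := by field_simp; norm_num
      _ ≤ _ := h6
      _ = (√(Real.log X) * √(Real.log X)) * countSOS X := by rw [← h7]
      _ = _ := by ring
  exact le_of_mul_le_mul_left h8 hs0

/-- The elementary symmetric sum of degree `m` of `w` over `S`. -/
def elemSymm (w : ℕ → ℝ) (S : Finset ℕ) (m : ℕ) : ℝ :=
  ∑ T ∈ S.powersetCard m, ∏ p ∈ T, w p

theorem elemSymm_zero (w : ℕ → ℝ) (S : Finset ℕ) : elemSymm w S 0 = 1 := by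
  simp [elemSymm]

theorem elemSymm_nonneg {w : ℕ → ℝ} {S : Finset ℕ} (hw : ∀ p ∈ S, 0 ≤ w p) (m : ℕ) :
    0 ≤ elemSymm w S m := by
  refine Finset.sum_nonneg fun T hT => Finset.prod_nonneg fun p hp => hw p ?_
  exact (Finset.mem_powersetCard.1 hT).1 hp

theorem elemSymm_insert_succ (w : ℕ → ℝ) {S : Finset ℕ} {a : ℕ} (ha : a ∉ S) (m : ℕ) :
    elemSymm w (insert a S) (m + 1) = elemSymm w S (m + 1) + w a * elemSymm w S m := by
  have hnot : ∀ T ∈ S.powersetCard m, a ∉ T := fun T hT h =>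
    ha ((Finset.mem_powersetCard.1 hT).1 h)
  rw [elemSymm, Finset.powersetCard_succ_insert ha, Finset.sum_union, Finset.sum_image]
  · simp only [elemSymm, Finset.mul_sum]
    congr 1
    refine Finset.sum_congr rfl fun T hT => ?_
    rw [Finset.prod_insert (hnot T hT)]
  · intro T hT T' hT' h
    have := congrArg (fun s => Finset.erase s a) h
    simpa [Finset.erase_insert (hnot T hT), Finset.erase_insert (hnot T' hT')] using this
  · rw [Finset.disjoint_left]
    intro T hT hT'
    obtain ⟨T', -, rfl⟩ := Finset.mem_image.1 hT'
    exact ha ((Finset.mem_powersetCard.1 hT).1 (Finset.mem_insert_self a T'))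

theorem sum_elemSymm_le_prod {w : ℕ → ℝ} {S : Finset ℕ} (hw : ∀ p ∈ S, 0 ≤ w p) (m : ℕ) :
    ∑ j ∈ Finset.range m, elemSymm w S j ≤ ∏ p ∈ S, (1 + w p) := by
  rw [Finset.prod_one_add, Finset.sum_powerset]
  simp only [elemSymm]
  rcases le_total m (S.card + 1) with h | h
  · refine Finset.sum_le_sum_of_subset_of_nonneg (Finset.range_mono h) fun j _ _ => ?_
    exact elemSymm_nonneg hw j
  · refine le_of_eq (Finset.sum_subset (Finset.range_mono h) fun j _ hj => ?_).symm
    rw [Finset.powersetCard_eq_empty.2 (by simpa using hj), Finset.sum_empty]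

theorem elemSymm_smul (w : ℕ → ℝ) (S : Finset ℕ) (u : ℝ) (m : ℕ) :
    elemSymm (fun p => u * w p) S m = u ^ m * elemSymm w S m := by
  rw [elemSymm, elemSymm, Finset.mul_sum]
  refine Finset.sum_congr rfl fun T hT => ?_
  rw [Finset.prod_mul_distrib, Finset.prod_const, (Finset.mem_powersetCard.1 hT).2]

theorem elemSymm_le_exp {w : ℕ → ℝ} {S : Finset ℕ} (hw : ∀ p ∈ S, 0 ≤ w p) (m : ℕ) :
    elemSymm w S m ≤ Real.exp (Real.exp 1 * ∑ p ∈ S, w p - m) := by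
  have hw' : ∀ p ∈ S, 0 ≤ Real.exp 1 * w p := fun p hp => mul_nonneg (Real.exp_pos _).le (hw p hp)
  have h1 := sum_elemSymm_le_prod hw' (m + 1)
  have h2 := Finset.single_le_sum (f := fun j => elemSymm (fun p => Real.exp 1 * w p) S j)
    (fun j _ => elemSymm_nonneg hw' j) (Finset.self_mem_range_succ m)
  simp only [elemSymm_smul] at h1 h2
  have h3 : ∏ p ∈ S, (1 + Real.exp 1 * w p) ≤ Real.exp (Real.exp 1 * ∑ p ∈ S, w p) := by
    rw [Finset.mul_sum, Real.exp_sum]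
    refine Finset.prod_le_prod (fun p hp => by linarith [hw' p hp]) fun p _ => ?_
    rw [add_comm]; exact Real.add_one_le_exp _
  have h4 := h2.trans (h1.trans h3)
  rw [Real.exp_sub, le_div_iff₀ (Real.exp_pos _), mul_comm]
  rwa [← Real.exp_nat_mul, mul_one] at h4

theorem sum_elemSymm_le_pow_mul_exp {b : ℕ → ℝ} {S : Finset ℕ} (hb : ∀ p ∈ S, 0 ≤ b p) (m : ℕ)
    {U : ℝ} (hU : 1 ≤ U) :
    ∑ j ∈ Finset.range (m + 1), elemSymm b S j ≤ U ^ m * Real.exp ((∑ p ∈ S, b p) / U) := by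
  have hU0 : 0 < U := by linarith
  have hb' : ∀ p ∈ S, 0 ≤ U⁻¹ * b p := fun p hp => mul_nonneg (inv_pos.2 hU0).le (hb p hp)
  have h1 := sum_elemSymm_le_prod hb' (m + 1)
  have h3 : ∏ p ∈ S, (1 + U⁻¹ * b p) ≤ Real.exp ((∑ p ∈ S, b p) / U) := by
    rw [div_eq_inv_mul, Finset.mul_sum, Real.exp_sum]
    refine Finset.prod_le_prod (fun p hp => by linarith [hb' p hp]) fun p _ => ?_
    rw [add_comm]; exact Real.add_one_le_exp _
  refine le_trans ?_ (mul_le_mul_of_nonneg_left (h1.trans h3) (by positivity))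
  rw [Finset.mul_sum]
  refine Finset.sum_le_sum fun j hj => ?_
  simp only [elemSymm_smul]
  have h0 := elemSymm_nonneg hb j
  have hjm : j ≤ m := by simp at hj; omega
  rw [← mul_assoc]
  refine le_mul_of_one_le_left h0 ?_
  rw [inv_pow, ← div_eq_mul_inv, one_le_div (by positivity)]
  exact pow_le_pow_right₀ hU hjm

/-- The inclusion-exclusion sum truncated at degree `m`. -/
def altElemSymm (w : ℕ → ℝ) (S : Finset ℕ) (m : ℕ) : ℝ :=
  ∑ j ∈ Finset.range (m + 1), (-1) ^ j * elemSymm w S j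

theorem altElemSymm_succ (w : ℕ → ℝ) (S : Finset ℕ) (m : ℕ) :
    altElemSymm w S (m + 1) = altElemSymm w S m + (-1) ^ (m + 1) * elemSymm w S (m + 1) := by
  rw [altElemSymm, Finset.sum_range_succ, altElemSymm]

theorem altElemSymm_insert (w : ℕ → ℝ) {S : Finset ℕ} {a : ℕ} (ha : a ∉ S) (m : ℕ) :
    altElemSymm w (insert a S) m =
      (1 - w a) * altElemSymm w S m + w a * ((-1) ^ m * elemSymm w S m) := by
  induction m with
  | zero => simp [altElemSymm, elemSymm_zero]
  | succ m ih =>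
    rw [altElemSymm_succ, ih, altElemSymm_succ, elemSymm_insert_succ w ha]
    ring

/-- Bonferroni's inequalities. -/
theorem bonferroni {w : ℕ → ℝ} {S : Finset ℕ} (hw : ∀ p ∈ S, 0 ≤ w p) (hw1 : ∀ p ∈ S, w p ≤ 1)
    (m : ℕ) : 0 ≤ (-1) ^ m * (altElemSymm w S m - ∏ p ∈ S, (1 - w p)) := by
  induction S using Finset.induction_on with
  | empty =>
    have : altElemSymm w ∅ m = 1 := by
      induction m with
      | zero => simp [altElemSymm, elemSymm_zero]
      | succ m ih =>
        rw [altElemSymm_succ, ih]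
        have : elemSymm w ∅ (m + 1) = 0 := by
          rw [elemSymm, Finset.powersetCard_eq_empty.2 (by simp), Finset.sum_empty]
        simp [this]
    simp [this]
  | insert a S ha ih =>
    have ih' := ih (fun p hp => hw p (by simp [hp])) (fun p hp => hw1 p (by simp [hp]))
    have h0 := hw a (by simp)
    have h1 := hw1 a (by simp)
    have he := elemSymm_nonneg (fun p hp => hw p (Finset.mem_insert_of_mem (b := a) hp)) m
    rw [altElemSymm_insert w ha, Finset.prod_insert ha]
    have e : (-1 : ℝ) ^ m * ((1 - w a) * altElemSymm w S m + w a * ((-1) ^ m * elemSymm w S m) -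
        (1 - w a) * ∏ p ∈ S, (1 - w p)) =
        (1 - w a) * ((-1) ^ m * (altElemSymm w S m - ∏ p ∈ S, (1 - w p))) +
        ((-1) ^ m * (-1) ^ m) * (w a * elemSymm w S m) := by ring
    rw [e, ← mul_pow]
    norm_num
    have : 0 ≤ (1 - w a) * ((-1) ^ m * (altElemSymm w S m - ∏ p ∈ S, (1 - w p))) :=
      mul_nonneg (by linarith) ih'
    have : 0 ≤ w a * elemSymm w S m := mul_nonneg h0 he
    linarith

section Sieve

variable (q : ℕ → ℕ) (Ω : ℕ → Finset ℕ)

theorem card_filter_forall_mod_mem (T : Finset ℕ) (hq : ∀ p ∈ T, 0 < q p)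
    (hco : ∀ p ∈ T, ∀ p' ∈ T, p ≠ p' → Nat.Coprime (q p) (q p'))
    (hΩ : ∀ p ∈ T, Ω p ⊆ Finset.range (q p)) :
    ((Finset.range (∏ p ∈ T, q p)).filter (fun r => ∀ p ∈ T, r % q p ∈ Ω p)).card =
      ∏ p ∈ T, (Ω p).card := by
  induction T using Finset.induction_on with
  | empty => simp
  | insert a T ha ih =>
    have ih' := ih (fun p hp => hq p (by simp [hp]))
      (fun p hp p' hp' => hco p (by simp [hp]) p' (by simp [hp'])) (fun p hp => hΩ p (by simp [hp]))
    set Q := ∏ p ∈ T, q p with hQ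
    have hcop : Nat.Coprime (q a) Q := by
      refine Nat.Coprime.prod_right fun p hp => hco a (by simp) p (by simp [hp]) ?_
      rintro rfl; exact ha hp
    have hQ0 : 0 < Q := Finset.prod_pos fun p hp => hq p (by simp [hp])
    have ha0 : 0 < q a := hq a (by simp)
    have hdvd : ∀ p ∈ T, q p ∣ Q := fun p hp => Finset.dvd_prod_of_mem q hp
    rw [Finset.prod_insert ha, Finset.prod_insert ha, ← hQ, ← ih', ← Finset.card_product]
    refine Finset.card_nbij' (fun r => (r % q a, r % Q))
      (fun x => (Nat.chineseRemainder hcop x.1 x.2 : ℕ)) ?_ ?_ ?_ ?_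
    · intro r hr
      simp only [Finset.coe_filter, Finset.mem_range, Finset.mem_insert, forall_eq_or_imp,
        Set.mem_ofPred_eq, Finset.coe_product, Set.mem_prod, Finset.mem_coe] at hr ⊢
      refine ⟨hr.2.1, Nat.mod_lt _ hQ0, fun p hp => ?_⟩
      rw [Nat.mod_mod_of_dvd _ (hdvd p hp)]
      exact hr.2.2 p hp
    · rintro ⟨x, y⟩ hx
      simp only [Finset.coe_filter, Finset.mem_range, Finset.mem_insert, forall_eq_or_imp,
        Set.mem_ofPred_eq, Finset.coe_product, Set.mem_prod, Finset.mem_coe] at hx ⊢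
      obtain ⟨h1, h2⟩ := (Nat.chineseRemainder hcop x y).2
      have hxlt := Finset.mem_range.1 (hΩ a (by simp) hx.1)
      refine ⟨Nat.chineseRemainder_lt_mul hcop x y ha0.ne' hQ0.ne', ?_, fun p hp => ?_⟩
      · rw [h1, Nat.mod_eq_of_lt hxlt]; exact hx.1
      · rw [h2.of_dvd (hdvd p hp)]; exact hx.2.2 p hp
    · intro r hr
      simp only [Finset.coe_filter, Finset.mem_range, Set.mem_ofPred_eq] at hr
      have h := Nat.chineseRemainder_modEq_unique hcop (a := r % q a) (b := r % Q) (z := r)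
        (Nat.mod_modEq _ _).symm (Nat.mod_modEq _ _).symm
      exact (Nat.ModEq.eq_of_lt_of_lt h hr.1
        (Nat.chineseRemainder_lt_mul hcop _ _ ha0.ne' hQ0.ne')).symm
    · rintro ⟨x, y⟩ hx
      simp only [Finset.coe_filter, Finset.mem_range, Set.mem_ofPred_eq, Finset.coe_product,
        Set.mem_prod, Finset.mem_coe] at hx
      obtain ⟨h1, h2⟩ := (Nat.chineseRemainder hcop x y).2
      have hxlt := Finset.mem_range.1 (hΩ a (by simp) hx.1)
      have e1 : (Nat.chineseRemainder hcop x y : ℕ) % q a = x := by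
        rw [h1, Nat.mod_eq_of_lt hxlt]
      have e2 : (Nat.chineseRemainder hcop x y : ℕ) % Q = y := by
        rw [h2, Nat.mod_eq_of_lt hx.2.1]
      simp only [e1, e2]

theorem abs_card_filter_forall_mod_mem_sub_le (T : Finset ℕ) (hq : ∀ p ∈ T, 0 < q p)
    (hco : ∀ p ∈ T, ∀ p' ∈ T, p ≠ p' → Nat.Coprime (q p) (q p'))
    (hΩ : ∀ p ∈ T, Ω p ⊆ Finset.range (q p)) (X : ℕ) :
    |(((Finset.range X).filter (fun n => ∀ p ∈ T, n % q p ∈ Ω p)).card : ℝ) -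
      X * ∏ p ∈ T, ((Ω p).card / q p : ℝ)| ≤ ∏ p ∈ T, ((Ω p).card : ℝ) := by
  set Q := ∏ p ∈ T, q p with hQ
  have hQ0 : 0 < Q := Finset.prod_pos hq
  have hQ0' : (0 : ℝ) < Q := by exact_mod_cast hQ0
  have hdvd : ∀ p ∈ T, q p ∣ Q := fun p hp => Finset.dvd_prod_of_mem q hp
  have hR := card_filter_forall_mod_mem q Ω T hq hco hΩ
  rw [← hQ] at hR
  set R := (Finset.range Q).filter (fun r => ∀ p ∈ T, r % q p ∈ Ω p) with hRdef
  have hmem : ∀ n, (∀ p ∈ T, n % q p ∈ Ω p) ↔ n % Q ∈ R := by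
    intro n
    simp only [hRdef, Finset.mem_filter, Finset.mem_range, Nat.mod_lt _ hQ0, true_and]
    refine forall₂_congr fun p hp => ?_
    rw [Nat.mod_mod_of_dvd _ (hdvd p hp)]
  have hfib := Finset.card_eq_sum_card_fiberwise (f := fun n => n % Q)
    (s := (Finset.range X).filter (fun n => ∀ p ∈ T, n % q p ∈ Ω p)) (t := R) (by
      intro n hn
      simp only [Finset.coe_filter, Set.mem_ofPred_eq] at hn
      exact (hmem n).1 hn.2)
  have hone : ∀ r ∈ R, |((((Finset.range X).filter (fun n => ∀ p ∈ T, n % q p ∈ Ω p)).filter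
      (fun n => n % Q = r)).card : ℝ) - X / Q| ≤ 1 := by
    intro r hr
    have hrQ : r < Q := by
      simp only [hRdef, Finset.mem_filter, Finset.mem_range] at hr; exact hr.1
    have e : ((Finset.range X).filter (fun n => ∀ p ∈ T, n % q p ∈ Ω p)).filter
        (fun n => n % Q = r) = (Finset.range X).filter (fun n => n ≡ r [MOD Q]) := by
      ext n
      simp only [Finset.mem_filter, Nat.ModEq, Nat.mod_eq_of_lt hrQ, and_assoc]
      constructor
      · rintro ⟨h1, -, h2⟩; exact ⟨h1, h2⟩
      · rintro ⟨h1, h2⟩; exact ⟨h1, (hmem n).2 (h2 ▸ hr), h2⟩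
    rw [e, ← Nat.count_eq_card_filter_range, Nat.count_modEq_card X hQ0]
    have h1 : (X : ℝ) / Q < ((X / Q : ℕ) : ℝ) + 1 := by
      rw [← Nat.floor_div_eq_div (K := ℝ)]
      exact Nat.lt_floor_add_one _
    have h2 : ((X / Q : ℕ) : ℝ) ≤ X / Q := Nat.cast_div_le
    rw [abs_le]
    push_cast
    split_ifs <;> constructor <;> norm_num <;> linarith
  have hRr : (∏ p ∈ T, ((Ω p).card : ℝ)) = R.card := by rw [hR]; push_cast; rfl
  have hprod : X * ∏ p ∈ T, ((Ω p).card / q p : ℝ) = ∑ r ∈ R, (X : ℝ) / Q := by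
    rw [Finset.prod_div_distrib, hRr, Finset.sum_const, nsmul_eq_mul, hQ]
    push_cast
    ring
  rw [hfib, hprod, hRr]
  push_cast
  rw [← Finset.sum_sub_distrib]
  refine (Finset.abs_sum_le_sum_abs _ _).trans ((Finset.sum_le_sum hone).trans ?_)
  simp

/-- Brun's pure sieve. -/
theorem brun_sieve (S : Finset ℕ) (hq : ∀ p ∈ S, 0 < q p)
    (hco : ∀ p ∈ S, ∀ p' ∈ S, p ≠ p' → Nat.Coprime (q p) (q p'))
    (hΩ : ∀ p ∈ S, Ω p ⊆ Finset.range (q p)) (X m : ℕ) (hm : Even m) (U : ℝ) (hU : 1 ≤ U) :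
    (((Finset.range X).filter (fun n => ∀ p ∈ S, n % q p ∉ Ω p)).card : ℝ) ≤
      X * (Real.exp (-∑ p ∈ S, ((Ω p).card / q p : ℝ)) +
        Real.exp (Real.exp 1 * ∑ p ∈ S, ((Ω p).card / q p : ℝ) - (m + 1 : ℕ))) +
      U ^ m * Real.exp ((∑ p ∈ S, ((Ω p).card : ℝ)) / U) := by
  classical
  set w : ℕ → ℝ := fun p => ((Ω p).card / q p : ℝ) with hw
  set b : ℕ → ℝ := fun p => ((Ω p).card : ℝ) with hb
  have hw0 : ∀ p ∈ S, 0 ≤ w p := fun p _ => by positivity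
  have hb0 : ∀ p ∈ S, 0 ≤ b p := fun p _ => by positivity
  have hw1 : ∀ p ∈ S, w p ≤ 1 := by
    intro p hp
    have h1 : (0 : ℝ) < q p := by exact_mod_cast hq p hp
    rw [hw]
    simp only
    rw [div_le_one h1]
    have := Finset.card_le_card (hΩ p hp)
    rw [Finset.card_range] at this
    exact_mod_cast this
  let ind : ℕ → ℕ → ℝ := fun n p => if n % q p ∈ Ω p then 1 else 0
  have hcount : (((Finset.range X).filter (fun n => ∀ p ∈ S, n % q p ∉ Ω p)).card : ℝ) ≤
      ∑ n ∈ Finset.range X, altElemSymm (ind n) S m := by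
    rw [Finset.card_filter]
    push_cast
    refine Finset.sum_le_sum fun n _ => ?_
    have h1 := bonferroni (w := ind n) (S := S)
      (fun p _ => by simp only [ind]; split_ifs <;> norm_num)
      (fun p _ => by simp only [ind]; split_ifs <;> norm_num) m
    rw [hm.neg_one_pow, one_mul, sub_nonneg] at h1
    refine le_trans ?_ h1
    split_ifs with h
    · rw [Finset.prod_eq_one]
      intro p hp
      simp [ind, h p hp]
    · refine Finset.prod_nonneg fun p _ => ?_
      simp only [ind]; split_ifs <;> norm_num
  have hswap : ∑ n ∈ Finset.range X, altElemSymm (ind n) S m =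
      ∑ j ∈ Finset.range (m + 1), (-1) ^ j * ∑ T ∈ S.powersetCard j,
        (((Finset.range X).filter (fun n => ∀ p ∈ T, n % q p ∈ Ω p)).card : ℝ) := by
    simp only [altElemSymm, elemSymm]
    rw [Finset.sum_comm]
    refine Finset.sum_congr rfl fun j _ => ?_
    rw [← Finset.mul_sum, Finset.sum_comm]
    congr 1
    refine Finset.sum_congr rfl fun T _ => ?_
    rw [Finset.card_filter]
    push_cast
    refine Finset.sum_congr rfl fun n _ => ?_
    simp only [ind]
    rw [Finset.prod_ite_zero]
    simp
  have hmain : ∑ n ∈ Finset.range X, altElemSymm (ind n) S m ≤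
      X * altElemSymm w S m + ∑ j ∈ Finset.range (m + 1), elemSymm b S j := by
    rw [hswap, altElemSymm, Finset.mul_sum, ← Finset.sum_add_distrib]
    refine Finset.sum_le_sum fun j _ => ?_
    have h1 : |∑ T ∈ S.powersetCard j,
        (((Finset.range X).filter (fun n => ∀ p ∈ T, n % q p ∈ Ω p)).card : ℝ) -
        X * elemSymm w S j| ≤ elemSymm b S j := by
      rw [elemSymm, elemSymm, Finset.mul_sum, ← Finset.sum_sub_distrib]
      refine (Finset.abs_sum_le_sum_abs _ _).trans (Finset.sum_le_sum fun T hT => ?_)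
      have hTS := (Finset.mem_powersetCard.1 hT).1
      exact abs_card_filter_forall_mod_mem_sub_le q Ω T (fun p hp => hq p (hTS hp))
        (fun p hp p' hp' => hco p (hTS hp) p' (hTS hp')) (fun p hp => hΩ p (hTS hp)) X
    rw [abs_le] at h1
    rcases neg_one_pow_eq_or ℝ j with h | h <;> rw [h] <;> linarith [h1.1, h1.2]
  have halt : altElemSymm w S m ≤ ∏ p ∈ S, (1 - w p) + elemSymm w S (m + 1) := by
    have h1 := bonferroni hw0 hw1 (m + 1)
    rw [altElemSymm_succ, pow_succ, hm.neg_one_pow] at h1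
    linarith
  have hprod : ∏ p ∈ S, (1 - w p) ≤ Real.exp (-∑ p ∈ S, w p) := by
    rw [← Finset.sum_neg_distrib, Real.exp_sum]
    refine Finset.prod_le_prod (fun p hp => by linarith [hw1 p hp]) fun p _ => ?_
    have := Real.add_one_le_exp (-w p)
    linarith
  have he := elemSymm_le_exp hw0 (m + 1)
  have hE := sum_elemSymm_le_pow_mul_exp hb0 m hU
  refine hcount.trans (hmain.trans (add_le_add ?_ hE))
  exact mul_le_mul_of_nonneg_left (by linarith) (Nat.cast_nonneg X)

end Sieve

/-- The primes `p ≡ 3 (mod 4)` up to `z`. -/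
def primesThreeMod (z : ℕ) : Finset ℕ :=
  (Finset.Ioc 0 z).filter (fun p => p.Prime ∧ p % 4 = 3)

theorem mem_primesThreeMod {z p : ℕ} : p ∈ primesThreeMod z ↔ p ≤ z ∧ p.Prime ∧ p % 4 = 3 := by
  simp only [primesThreeMod, Finset.mem_filter, Finset.mem_Ioc]
  exact ⟨fun h => ⟨h.1.2, h.2⟩, fun h => ⟨⟨h.2.1.pos, h.1⟩, h.2⟩⟩

/-- Residues `r` modulo `p ^ 2` for which `p` divides `r + h` exactly once. -/
def exactResidues (p h : ℕ) : Finset ℕ :=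
  (Finset.range (p ^ 2)).filter (fun r => p ∣ r + h ∧ ¬ p ^ 2 ∣ r + h)

theorem card_exactResidues {p : ℕ} (hp : 0 < p) (h : ℕ) : (exactResidues p h).card = p - 1 := by
  have hper : Function.Periodic (fun r : ℕ => p ∣ r ∧ ¬ p ^ 2 ∣ r) (p ^ 2) := by
    intro r
    have h1 : p ∣ r + p ^ 2 ↔ p ∣ r :=
      (Nat.dvd_add_iff_left (Dvd.intro_left _ (pow_succ p 1).symm)).symm
    have h2 : p ^ 2 ∣ r + p ^ 2 ↔ p ^ 2 ∣ r := Nat.dvd_add_self_right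
    simp only [h1, h2]
  have h1 : (exactResidues p h).card =
      ((Finset.Ico h (h + p ^ 2)).filter (fun r => p ∣ r ∧ ¬ p ^ 2 ∣ r)).card := by
    refine Finset.card_bij (fun r _ => r + h) ?_ ?_ ?_
    · intro r hr
      simp only [exactResidues, Finset.mem_filter, Finset.mem_range] at hr
      simp only [Finset.mem_filter, Finset.mem_Ico]
      exact ⟨⟨by omega, by omega⟩, hr.2⟩
    · intro a _ b _ hab
      omega
    · intro b hb
      simp only [Finset.mem_filter, Finset.mem_Ico] at hb
      refine ⟨b - h, ?_, by omega⟩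
      simp only [exactResidues, Finset.mem_filter, Finset.mem_range]
      rw [Nat.sub_add_cancel hb.1.1]
      exact ⟨by omega, hb.2⟩
  rw [h1, Nat.filter_Ico_card_eq_of_periodic _ _ _ hper, Nat.count_eq_card_filter_range]
  have h2 : (Finset.range (p ^ 2)).filter (fun r => p ∣ r ∧ ¬ p ^ 2 ∣ r) =
      (Finset.Ico 1 p).image (fun k => p * k) := by
    ext r
    simp only [Finset.mem_filter, Finset.mem_range, Finset.mem_image, Finset.mem_Ico]
    constructor
    · rintro ⟨h1, ⟨k, rfl⟩, h3⟩
      refine ⟨k, ⟨?_, ?_⟩, rfl⟩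
      · rcases Nat.eq_zero_or_pos k with rfl | hk
        · simp at h3
        · exact hk
      · rw [sq] at h1
        exact lt_of_mul_lt_mul_left h1 (Nat.zero_le _)
    · rintro ⟨k, ⟨h1, h2⟩, rfl⟩
      refine ⟨?_, Dvd.intro _ rfl, ?_⟩
      · rw [sq]
        exact Nat.mul_lt_mul_of_pos_left h2 hp
      · rw [sq]
        intro hd
        exact absurd (Nat.le_of_dvd h1 (Nat.dvd_of_mul_dvd_mul_left hp hd)) (by omega)
  rw [h2, Finset.card_image_of_injective _ (fun a b hab => Nat.eq_of_mul_eq_mul_left hp hab),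
    Nat.card_Ico]

/-- Residues excluded modulo `p ^ 2` when both `n` and `n + h` are sums of two squares. -/
def pairResidues (h p : ℕ) : Finset ℕ := exactResidues p 0 ∪ exactResidues p h

theorem pairResidues_subset (h p : ℕ) : pairResidues h p ⊆ Finset.range (p ^ 2) :=
  Finset.union_subset (Finset.filter_subset _ _) (Finset.filter_subset _ _)

theorem card_pairResidues_le {p : ℕ} (hp : 0 < p) (h : ℕ) : (pairResidues h p).card ≤ 2 * p := by
  refine (Finset.card_union_le _ _).trans ?_
  rw [card_exactResidues hp, card_exactResidues hp]
  omega

theorem le_card_pairResidues {p : ℕ} (hp : 0 < p) (h : ℕ) : p - 1 ≤ (pairResidues h p).card := by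
  rw [← card_exactResidues hp 0]
  exact Finset.card_le_card Finset.subset_union_left

theorem card_pairResidues_of_not_dvd {p h : ℕ} (hp : 0 < p) (hd : ¬ p ∣ h) :
    (pairResidues h p).card = 2 * (p - 1) := by
  rw [pairResidues, Finset.card_union_of_disjoint, card_exactResidues hp, card_exactResidues hp]
  · ring
  · rw [Finset.disjoint_left]
    intro r hr hr'
    simp only [exactResidues, Finset.mem_filter, add_zero] at hr hr'
    exact hd ((Nat.dvd_add_right hr.2.1).1 hr'.2.1)

theorem mod_sq_notMem_exactResidues {n h p : ℕ} (hn : n + h ∈ SOS) (hp : p.Prime)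
    (h3 : p % 4 = 3) : n % p ^ 2 ∉ exactResidues p h := by
  simp only [exactResidues, Finset.mem_filter, not_and, not_not]
  intro _ hd
  have key : n + h = (n % p ^ 2 + h) + p ^ 2 * (n / p ^ 2) := by
    have := Nat.mod_add_div n (p ^ 2)
    omega
  have h1 : p ∣ n + h := by
    rw [key]
    exact dvd_add hd (Dvd.dvd.mul_right (dvd_pow_self p two_ne_zero) _)
  have h2 := sq_dvd_of_mem_SOS hn hp h3 h1
  rw [key] at h2
  exact (Nat.dvd_add_left (Dvd.intro _ rfl)).1 h2

theorem mod_sq_notMem_pairResidues {n h p : ℕ} (hn : n ∈ SOS) (hnh : n + h ∈ SOS) (hp : p.Prime)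
    (h3 : p % 4 = 3) : n % p ^ 2 ∉ pairResidues h p := by
  rw [pairResidues, Finset.mem_union, not_or]
  exact ⟨mod_sq_notMem_exactResidues (by simpa using hn) hp h3,
    mod_sq_notMem_exactResidues hnh hp h3⟩

/-- The sieving level attached to `X`. -/
def sieveLevel (X : ℕ) : ℕ := ⌊Real.exp (Real.log X / (48 * Real.log (Real.log X)))⌋₊

theorem tendsto_log_natCast : Tendsto (fun X : ℕ => Real.log X) atTop atTop :=
  Real.tendsto_log_atTop.comp tendsto_natCast_atTop_atTop

theorem tendsto_log_log_natCast : Tendsto (fun X : ℕ => Real.log (Real.log X)) atTop atTop :=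
  Real.tendsto_log_atTop.comp tendsto_log_natCast

theorem eventually_log_log_le : ∀ᶠ X : ℕ in atTop,
    2 ≤ Real.log (Real.log X) ∧ 96 * Real.log (Real.log X) ≤ Real.log X := by
  have h1 : ∀ᶠ x : ℝ in atTop, Real.log x ≤ 1 / 96 * x := by
    have := Real.isLittleO_log_id_atTop.bound (show (0 : ℝ) < 1 / 96 by norm_num)
    filter_upwards [this, eventually_ge_atTop (1 : ℝ)] with x hx hx1
    rw [Real.norm_eq_abs, Real.norm_eq_abs, id, abs_of_nonneg (a := x) (by linarith)] at hx
    exact (le_abs_self _).trans hx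
  filter_upwards [tendsto_log_log_natCast.eventually_ge_atTop 2,
    tendsto_log_natCast.eventually h1] with X h2 h3
  exact ⟨h2, by linarith⟩

theorem log_sieveLevel_bounds {X : ℕ} (h2 : 2 ≤ Real.log (Real.log X))
    (h96 : 96 * Real.log (Real.log X) ≤ Real.log X) :
    2 ≤ sieveLevel X ∧ Real.log (sieveLevel X) ≤ Real.log X / (48 * Real.log (Real.log X)) ∧
      Real.log X / (96 * Real.log (Real.log X)) ≤ Real.log (sieveLevel X) := by
  set L := Real.log (Real.log X)
  set a := Real.log X / (48 * L) with ha
  have ha2 : 2 ≤ a := by rw [ha, le_div_iff₀ (by linarith)]; linarith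
  have hz1 : (sieveLevel X : ℝ) ≤ Real.exp a := Nat.floor_le (Real.exp_pos _).le
  have hz2 : Real.exp a < sieveLevel X + 1 := Nat.lt_floor_add_one _
  have h3 : Real.exp a = Real.exp (a / 2) * Real.exp (a / 2) := by
    rw [← Real.exp_add]; ring_nf
  have h4 : 2 ≤ Real.exp (a / 2) := by have := Real.add_one_le_exp (a / 2); linarith
  have h5 : Real.exp (a / 2) ≤ sieveLevel X := by nlinarith
  have h6 : (2 : ℝ) ≤ sieveLevel X := h4.trans h5
  refine ⟨by exact_mod_cast h6, ?_, ?_⟩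
  · rw [Real.log_le_iff_le_exp (by linarith)]
    exact hz1
  · rw [Real.le_log_iff_exp_le (by linarith)]
    convert h5 using 2
    rw [ha]
    field_simp
    ring

open Classical in
/-- The number of `n < X` with both `n` and `n + h` sums of two squares. -/
def countPairs (X h : ℕ) : ℕ := ((Finset.range X).filter (fun n => n ∈ SOS ∧ n + h ∈ SOS)).card

theorem exists_countPairs_le_exp : ∃ C : ℝ, 0 < C ∧ ∀ᶠ X : ℕ in atTop, ∀ h : ℕ,
    (countPairs X h : ℝ) ≤ X * Real.exp (-∑ p ∈ primesThreeMod (sieveLevel X),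
      ((pairResidues h p).card / (p ^ 2 : ℕ) : ℝ)) + C * X / Real.log X := by
  classical
  obtain ⟨C, hC⟩ := exists_abs_sum_prime_three_mod_four_inv_sub_le
  have hC0 : 0 ≤ C := (abs_nonneg _).trans (hC 2 le_rfl)
  refine ⟨Real.exp (6 * C) + 1, by positivity, ?_⟩
  filter_upwards [eventually_log_log_le, eventually_ge_atTop 1] with X ⟨hL2, hL96⟩ hX1 h
  obtain ⟨hz2, hzu, hzl⟩ := log_sieveLevel_bounds hL2 hL96
  set z := sieveLevel X
  set l := Real.log X with hl
  set L := Real.log l with hL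
  have hlpos : 0 < l := by linarith
  have hXpos : (0 : ℝ) < X := by exact_mod_cast hX1
  have hz2' : (2 : ℝ) ≤ z := by exact_mod_cast hz2
  set S := primesThreeMod z
  set sw := ∑ p ∈ S, ((pairResidues h p).card / (p ^ 2 : ℕ) : ℝ) with hsw
  have hSprime : ∀ p ∈ S, p.Prime := fun p hp => (mem_primesThreeMod.1 hp).2.1
  have hswle : sw ≤ L + 2 * C := by
    have h1 : sw ≤ 2 * ∑ p ∈ S, 1 / (p : ℝ) := by
      rw [Finset.mul_sum]
      refine Finset.sum_le_sum fun p hp => ?_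
      have hp0 : (0 : ℝ) < p := by exact_mod_cast (hSprime p hp).pos
      have h2 : ((pairResidues h p).card : ℝ) ≤ 2 * p := by
        exact_mod_cast card_pairResidues_le (hSprime p hp).pos h
      push_cast
      rw [div_le_iff₀ (by positivity)]
      calc ((pairResidues h p).card : ℝ) ≤ 2 * p := h2
        _ = 2 * (1 / (p : ℝ)) * (p : ℝ) ^ 2 := by field_simp
    have h2 := (abs_le.1 (hC z hz2)).2
    have h3 : Real.log (Real.log z) ≤ L := by
      refine Real.log_le_log (Real.log_pos (by linarith)) (hzu.trans ?_)
      exact div_le_self hlpos.le (by linarith)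
    have h4 : ∑ p ∈ S, 1 / (p : ℝ) - Real.log (Real.log z) / 2 ≤ C := h2
    linarith
  have hsw0 : 0 ≤ sw := Finset.sum_nonneg fun p _ => by positivity
  set k := ⌈2 * L⌉₊
  have hk1 : 2 * L ≤ k := Nat.le_ceil _
  have hk2 : (k : ℝ) < 2 * L + 1 := Nat.ceil_lt_add_one (by linarith)
  set U : ℝ := 2 * (z : ℝ) ^ 2 with hU
  have hU1 : 1 ≤ U := by nlinarith
  have hsieve := brun_sieve (fun p => p ^ 2) (pairResidues h) S
    (fun p hp => pow_pos (hSprime p hp).pos 2)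
    (fun p hp p' hp' hne => Nat.Coprime.pow 2 2
      ((Nat.coprime_primes (hSprime p hp) (hSprime p' hp')).2 hne))
    (fun p _ => pairResidues_subset h p) X (2 * k) (even_two_mul k) U hU1
  have hcount : (countPairs X h : ℝ) ≤
      (((Finset.range X).filter (fun n => ∀ p ∈ S, n % p ^ 2 ∉ pairResidues h p)).card : ℝ) := by
    rw [countPairs]
    refine Nat.cast_le.2 (Finset.card_le_card ?_)
    intro n hn
    simp only [Finset.mem_filter] at hn ⊢
    exact ⟨hn.1, fun p hp => mod_sq_notMem_pairResidues hn.2.1 hn.2.2 (hSprime p hp)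
      (mem_primesThreeMod.1 hp).2.2⟩
  have hexpL : Real.exp L = l := Real.exp_log hlpos
  have hexpl : Real.exp l = X := Real.exp_log hXpos
  have hB : Real.exp (Real.exp 1 * sw - (2 * k + 1 : ℕ)) ≤ Real.exp (6 * C) / l := by
    rw [← hexpL, ← Real.exp_sub]
    refine Real.exp_le_exp.2 ?_
    push_cast
    have he : Real.exp 1 ≤ 3 := by have := Real.exp_one_lt_d9; linarith
    have := mul_le_mul he hswle hsw0 (by norm_num)
    linarith
  have hD : U ^ (2 * k) * Real.exp ((∑ p ∈ S, ((pairResidues h p).card : ℝ)) / U) ≤ X / l := by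
    have h1 : (∑ p ∈ S, ((pairResidues h p).card : ℝ)) / U ≤ 1 := by
      rw [div_le_one (by linarith)]
      have h2 : ∀ p ∈ S, ((pairResidues h p).card : ℝ) ≤ 2 * z := by
        intro p hp
        have h3 : (pairResidues h p).card ≤ 2 * z :=
          (card_pairResidues_le (hSprime p hp).pos h).trans
            (Nat.mul_le_mul_left 2 (mem_primesThreeMod.1 hp).1)
        exact_mod_cast h3
      refine (Finset.sum_le_card_nsmul _ _ _ h2).trans ?_
      have h4 : S.card ≤ z := by
        refine (Finset.card_filter_le _ _).trans ?_
        simp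
      have h5 : (S.card : ℝ) ≤ z := by exact_mod_cast h4
      rw [nsmul_eq_mul, hU]
      nlinarith
    have hU2 : U ≤ Real.exp (1 + 2 * (l / (48 * L))) := by
      rw [Real.exp_add]
      have h2 : (2 : ℝ) ≤ Real.exp 1 := by have := Real.exp_one_gt_d9; linarith
      have h3 : (z : ℝ) ^ 2 ≤ Real.exp (2 * (l / (48 * L))) := by
        rw [two_mul, Real.exp_add, ← sq]
        refine pow_le_pow_left₀ (by linarith) ?_ 2
        exact (Real.log_le_iff_le_exp (by linarith)).1 hzu
      exact mul_le_mul h2 h3 (by positivity) (Real.exp_pos _).le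
    have h3 : U ^ (2 * k) ≤ Real.exp ((2 * k : ℕ) * (1 + 2 * (l / (48 * L)))) := by
      rw [Real.exp_nat_mul]
      exact pow_le_pow_left₀ (by linarith) hU2 _
    calc U ^ (2 * k) * Real.exp ((∑ p ∈ S, ((pairResidues h p).card : ℝ)) / U)
        ≤ Real.exp ((2 * k : ℕ) * (1 + 2 * (l / (48 * L)))) * Real.exp 1 :=
          mul_le_mul h3 (Real.exp_le_exp.2 h1) (Real.exp_pos _).le (Real.exp_pos _).le
      _ ≤ X / l := by
          rw [← hexpL, ← hexpl, ← Real.exp_sub, ← Real.exp_add]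
          refine Real.exp_le_exp.2 ?_
          rw [hexpL]
          push_cast
          have h4 : 2 * (k : ℝ) ≤ 5 * L := by linarith
          have h5 : 0 ≤ l / (48 * L) := by positivity
          have h6 : 2 * (k : ℝ) * (1 + 2 * (l / (48 * L))) ≤
              5 * L * (1 + 2 * (l / (48 * L))) :=
            mul_le_mul_of_nonneg_right h4 (by linarith)
          have h7 : 5 * L * (1 + 2 * (l / (48 * L))) = 5 * L + 10 / 48 * l := by
            have : L ≠ 0 := by linarith
            field_simp
            ring
          linarith
  have hB' := mul_le_mul_of_nonneg_left hB hXpos.le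
  calc (countPairs X h : ℝ) ≤ _ := hcount
    _ ≤ _ := hsieve
    _ ≤ X * Real.exp (-sw) + X * (Real.exp (6 * C) / l) + X / l := by
        rw [mul_add]
        exact add_le_add (add_le_add_right hB' _) hD
    _ = X * Real.exp (-sw) + (Real.exp (6 * C) + 1) * X / l := by ring

theorem exists_sum_primesThreeMod_inv_sq_le :
    ∃ D : ℝ, 0 ≤ D ∧ ∀ z : ℕ, ∑ p ∈ primesThreeMod z, 1 / (p : ℝ) ^ 2 ≤ D :=
  ⟨∑' n : ℕ, 1 / (n : ℝ) ^ 2, tsum_nonneg fun n => by positivity, fun _ =>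
    (Real.summable_one_div_nat_pow.2 one_lt_two).sum_le_tsum _ fun n _ => by positivity⟩

theorem inv_sub_inv_sq_le_density {p : ℕ} (hp : 0 < p) (h : ℕ) :
    1 / (p : ℝ) - 1 / (p : ℝ) ^ 2 ≤ ((pairResidues h p).card / (p ^ 2 : ℕ) : ℝ) := by
  have hp0 : (0 : ℝ) < p := by exact_mod_cast hp
  have h1 : ((p - 1 : ℕ) : ℝ) ≤ (pairResidues h p).card :=
    Nat.cast_le.2 (le_card_pairResidues hp h)
  rw [Nat.cast_sub hp] at h1
  push_cast at h1 ⊢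
  rw [le_div_iff₀ (by positivity)]
  calc (1 / (p : ℝ) - 1 / (p : ℝ) ^ 2) * (p : ℝ) ^ 2 = p - 1 := by field_simp
    _ ≤ _ := h1

theorem two_mul_inv_sub_inv_sq_le_density {p : ℕ} (hp : 0 < p) (h : ℕ) :
    2 * (1 / (p : ℝ)) - 2 * (1 / (p : ℝ) ^ 2) - (if p ∣ h then 1 / (p : ℝ) else 0) ≤
      ((pairResidues h p).card / (p ^ 2 : ℕ) : ℝ) := by
  have hp0 : (0 : ℝ) < p := by exact_mod_cast hp
  split_ifs with hd
  · have h1 := inv_sub_inv_sq_le_density hp h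
    have : 0 ≤ 1 / (p : ℝ) ^ 2 := by positivity
    linarith
  · rw [card_pairResidues_of_not_dvd hp hd]
    rw [Nat.cast_mul, Nat.cast_sub hp]
    push_cast
    rw [sub_zero]
    apply le_of_eq
    field_simp

theorem le_log_log_sieveLevel {X : ℕ} (h2 : 2 ≤ Real.log (Real.log X))
    (h96 : 96 * Real.log (Real.log X) ≤ Real.log X) :
    Real.log (Real.log X) - Real.log (96 * Real.log (Real.log X)) ≤
      Real.log (Real.log (sieveLevel X)) := by
  rw [← Real.log_div (by linarith) (by linarith)]
  exact Real.log_le_log (div_pos (by linarith) (by linarith)) (log_sieveLevel_bounds h2 h96).2.2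

theorem exists_countPairs_zero_le : ∃ C : ℝ, 0 < C ∧ ∀ᶠ X : ℕ in atTop,
    (countPairs X 0 : ℝ) ≤ C * X * Real.log (Real.log X) / √(Real.log X) := by
  obtain ⟨C, hC⟩ := exists_abs_sum_prime_three_mod_four_inv_sub_le
  obtain ⟨D, hD0, hD⟩ := exists_sum_primesThreeMod_inv_sq_le
  obtain ⟨A, hA0, hA⟩ := exists_countPairs_le_exp
  refine ⟨Real.exp (C + D) * 96 + A, by positivity, ?_⟩
  filter_upwards [eventually_log_log_le, eventually_ge_atTop 1, hA] with X ⟨hL2, hL96⟩ hX1 hX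
  obtain ⟨hz2, hzu, hzl⟩ := log_sieveLevel_bounds hL2 hL96
  have hlow := le_log_log_sieveLevel hL2 hL96
  set z := sieveLevel X
  set l := Real.log X with hl
  set L := Real.log l with hL
  have hlpos : 0 < l := by linarith
  have hXpos : (0 : ℝ) < X := by exact_mod_cast hX1
  have hsq : √l = Real.exp (L / 2) := by
    rw [Real.sqrt_eq_iff_mul_self_eq hlpos.le (Real.exp_pos _).le, ← Real.exp_add, add_halves,
      Real.exp_log hlpos]
  have hsum : L / 2 - Real.log (96 * L) / 2 - C - D ≤ ∑ p ∈ primesThreeMod z,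
      ((pairResidues 0 p).card / (p ^ 2 : ℕ) : ℝ) := by
    have h1 : ∑ p ∈ primesThreeMod z, (1 / (p : ℝ) - 1 / (p : ℝ) ^ 2) ≤
        ∑ p ∈ primesThreeMod z, ((pairResidues 0 p).card / (p ^ 2 : ℕ) : ℝ) :=
      Finset.sum_le_sum fun p hp => inv_sub_inv_sq_le_density (mem_primesThreeMod.1 hp).2.1.pos 0
    rw [Finset.sum_sub_distrib] at h1
    have h2 : -C ≤ ∑ p ∈ primesThreeMod z, 1 / (p : ℝ) - Real.log (Real.log z) / 2 :=
      (abs_le.1 (hC z hz2)).1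
    have h3 := hD z
    linarith
  have hlog : 0 ≤ Real.log (96 * L) := Real.log_nonneg (by linarith)
  have hexp : Real.exp (-∑ p ∈ primesThreeMod z, ((pairResidues 0 p).card / (p ^ 2 : ℕ) : ℝ)) ≤
      Real.exp (C + D) * 96 * L / √l := by
    calc _ ≤ Real.exp ((C + D) + Real.log (96 * L) - L / 2) := Real.exp_le_exp.2 (by linarith)
      _ = _ := by
        rw [Real.exp_sub, Real.exp_add, Real.exp_log (by linarith), hsq]
        ring
  have h1 : A * X / l ≤ A * X * L / √l := by
    have hs1 : 1 ≤ √l := Real.one_le_sqrt.2 (by linarith)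
    have hs2 : √l * √l = l := Real.mul_self_sqrt hlpos.le
    rw [div_le_div_iff₀ hlpos (by linarith), mul_assoc (A * X)]
    refine mul_le_mul_of_nonneg_left ?_ (by positivity)
    nlinarith
  calc (countPairs X 0 : ℝ) ≤ _ := hX 0
    _ ≤ X * (Real.exp (C + D) * 96 * L / √l) + A * X * L / √l :=
      add_le_add (mul_le_mul_of_nonneg_left hexp hXpos.le) h1
    _ = _ := by ring

theorem exists_countPairs_le : ∃ C : ℝ, 0 < C ∧ ∀ᶠ X : ℕ in atTop, ∀ k : ℕ, 1 ≤ k → ∀ h : ℕ,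
    1 ≤ h → h ≤ 2 ^ k →
    (countPairs X h : ℝ) ≤ C * k * X * Real.log (Real.log X) / Real.log X := by
  obtain ⟨C, hC⟩ := exists_abs_sum_prime_three_mod_four_inv_sub_le
  obtain ⟨D, hD0, hD⟩ := exists_sum_primesThreeMod_inv_sq_le
  obtain ⟨A, hA0, hA⟩ := exists_countPairs_le_exp
  refine ⟨Real.exp (3 * C + 2 * D) * 96 + A, by positivity, ?_⟩
  filter_upwards [eventually_log_log_le, eventually_ge_atTop 1, hA] with X ⟨hL2, hL96⟩ hX1 hX k hk
    h hh1 hh2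
  obtain ⟨hz2, hzu, hzl⟩ := log_sieveLevel_bounds hL2 hL96
  have hlow := le_log_log_sieveLevel hL2 hL96
  set z := sieveLevel X
  set l := Real.log X with hl
  set L := Real.log l with hL
  have hlpos : 0 < l := by linarith
  have hXpos : (0 : ℝ) < X := by exact_mod_cast hX1
  have hk1 : (1 : ℝ) ≤ k := by exact_mod_cast hk
  have hdvd : ∑ p ∈ primesThreeMod z, (if p ∣ h then 1 / (p : ℝ) else 0) ≤ Real.log k + C := by
    rw [← Finset.sum_filter]
    have h1 : (primesThreeMod z).filter (fun p => p ∣ h) ⊆ primesThreeMod (2 ^ k) := by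
      intro p hp
      rw [Finset.mem_filter, mem_primesThreeMod] at hp
      exact mem_primesThreeMod.2 ⟨(Nat.le_of_dvd hh1 hp.2).trans hh2, hp.1.2⟩
    refine (Finset.sum_le_sum_of_subset_of_nonneg h1 fun p _ _ => by positivity).trans ?_
    have h2 : ∑ p ∈ primesThreeMod (2 ^ k), 1 / (p : ℝ) -
        Real.log (Real.log (2 ^ k : ℕ)) / 2 ≤ C :=
      (abs_le.1 (hC (2 ^ k) (Nat.le_self_pow (by omega) 2))).2
    have h3 : Real.log (Real.log (2 ^ k : ℕ)) ≤ Real.log k := by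
      push_cast
      rw [Real.log_pow]
      have h4 : 0 < Real.log 2 := Real.log_pos one_lt_two
      have h5 : Real.log 2 ≤ 1 := by have := Real.log_two_lt_d9; linarith
      refine Real.log_le_log (by positivity) ?_
      exact mul_le_of_le_one_right (by linarith) h5
    have h4 : 0 ≤ Real.log k := Real.log_nonneg hk1
    linarith
  have hsum : L - Real.log (96 * L) - 3 * C - 2 * D - Real.log k ≤ ∑ p ∈ primesThreeMod z,
      ((pairResidues h p).card / (p ^ 2 : ℕ) : ℝ) := by
    have h1 : ∑ p ∈ primesThreeMod z, (2 * (1 / (p : ℝ)) - 2 * (1 / (p : ℝ) ^ 2) -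
        (if p ∣ h then 1 / (p : ℝ) else 0)) ≤
        ∑ p ∈ primesThreeMod z, ((pairResidues h p).card / (p ^ 2 : ℕ) : ℝ) :=
      Finset.sum_le_sum fun p hp =>
        two_mul_inv_sub_inv_sq_le_density (mem_primesThreeMod.1 hp).2.1.pos h
    rw [Finset.sum_sub_distrib, Finset.sum_sub_distrib, ← Finset.mul_sum, ← Finset.mul_sum] at h1
    have h2 : -C ≤ ∑ p ∈ primesThreeMod z, 1 / (p : ℝ) - Real.log (Real.log z) / 2 :=
      (abs_le.1 (hC z hz2)).1
    have h3 := hD z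
    linarith
  have hexp : Real.exp (-∑ p ∈ primesThreeMod z, ((pairResidues h p).card / (p ^ 2 : ℕ) : ℝ)) ≤
      Real.exp (3 * C + 2 * D) * 96 * k * L / l := by
    calc _ ≤ Real.exp ((3 * C + 2 * D) + Real.log (96 * L) + Real.log k - L) :=
          Real.exp_le_exp.2 (by linarith)
      _ = _ := by
        rw [Real.exp_sub, Real.exp_add, Real.exp_add, Real.exp_log (by linarith),
          Real.exp_log (by linarith), Real.exp_log hlpos]
        ring
  have h1 : A * X / l ≤ A * k * X * L / l := by
    refine div_le_div_of_nonneg_right ?_ hlpos.le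
    have : 1 ≤ k * L := by nlinarith
    have h2 := mul_le_mul_of_nonneg_left this (show 0 ≤ A * X by positivity)
    linarith
  calc (countPairs X h : ℝ) ≤ _ := hX h
    _ ≤ X * (Real.exp (3 * C + 2 * D) * 96 * k * L / l) + A * k * X * L / l :=
      add_le_add (mul_le_mul_of_nonneg_left hexp hXpos.le) h1
    _ = _ := by ring

open Classical in
/-- The sums of two squares `n ≠ m` with `|n - m| ≤ 2 ^ j`. -/
def window (m j : ℕ) : Finset ℕ :=
  (Finset.range (m + 2 ^ j + 1)).filter (fun n => n ∈ SOS ∧ n ≠ m ∧ m ≤ n + 2 ^ j)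

theorem mem_window {m j n : ℕ} :
    n ∈ window m j ↔ n ∈ SOS ∧ n ≠ m ∧ m ≤ n + 2 ^ j ∧ n ≤ m + 2 ^ j := by
  simp only [window, Finset.mem_filter, Finset.mem_range, Nat.lt_succ_iff]
  tauto

/-- The exceptional density factor for windows around `m`. -/
def windowDensity (m : ℕ) : ℝ := Real.log (Real.log m) ^ 3 / √(Real.log m)

/-- All short dyadic windows around `m` contain few sums of two squares. -/
def GoodWindows (m : ℕ) : Prop :=
  ∀ j : ℕ, 1 ≤ j → 2 ^ j ≤ m → ((window m j).card : ℝ) ≤ 2 ^ j * (j : ℝ) ^ 2 * windowDensity m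

open Classical in
theorem card_window_le (m j : ℕ) : (window m j).card ≤
    ∑ h ∈ Finset.Ioc 0 (2 ^ j), ((if m + h ∈ SOS then 1 else 0) +
      (if h ≤ m ∧ m - h ∈ SOS then 1 else 0)) := by
  rw [Finset.sum_add_distrib, ← Finset.card_filter, ← Finset.card_filter]
  have hsub : window m j ⊆
      ((Finset.Ioc 0 (2 ^ j)).filter (fun h => m + h ∈ SOS)).image (fun h => m + h) ∪
      ((Finset.Ioc 0 (2 ^ j)).filter (fun h => h ≤ m ∧ m - h ∈ SOS)).image (fun h => m - h) := by
    intro n hn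
    obtain ⟨h1, h2, h3, h4⟩ := mem_window.1 hn
    simp only [Finset.mem_union, Finset.mem_image, Finset.mem_filter, Finset.mem_Ioc]
    rcases lt_or_gt_of_ne h2 with hlt | hgt
    · right
      have : m - (m - n) = n := by omega
      exact ⟨m - n, ⟨⟨by omega, by omega⟩, by omega, by rwa [this]⟩, this⟩
    · left
      have : m + (n - m) = n := by omega
      exact ⟨n - m, ⟨⟨by omega, by omega⟩, by rwa [this]⟩, this⟩
  exact (Finset.card_le_card hsub).trans ((Finset.card_union_le _ _).trans
    (add_le_add Finset.card_image_le Finset.card_image_le))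

open Classical in
theorem sum_card_window_le (N j : ℕ) :
    ∑ m ∈ (Finset.range N).filter (· ∈ SOS), (window m j).card ≤
      2 * ∑ h ∈ Finset.Ioc 0 (2 ^ j), countPairs N h := by
  refine (Finset.sum_le_sum fun m _ => card_window_le m j).trans ?_
  rw [Finset.sum_comm, Finset.mul_sum]
  refine Finset.sum_le_sum fun h _ => ?_
  rw [Finset.sum_add_distrib, ← Finset.card_filter, ← Finset.card_filter, two_mul]
  refine add_le_add (le_of_eq ?_) ?_
  · rw [countPairs, Finset.filter_filter]
  · rw [countPairs]
    refine Finset.card_le_card_of_injOn (fun m => m - h) ?_ ?_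
    · intro m hm
      simp only [Finset.coe_filter, Finset.mem_filter, Finset.mem_range, Set.mem_ofPred_eq] at hm ⊢
      exact ⟨by omega, hm.2.2, by rw [Nat.sub_add_cancel hm.2.1]; exact hm.1.2⟩
    · intro a ha b hb hab
      simp only [Finset.coe_filter, Finset.mem_filter, Finset.mem_range, Set.mem_ofPred_eq] at ha hb
      simp only at hab
      omega

theorem windowDensity_ge {N m : ℕ} (hL : 2 ≤ Real.log (Real.log N)) (hm : m < N)
    (hNm : N ≤ m * m) :
    (Real.log (Real.log N) / 2) ^ 3 / √(Real.log N) ≤ windowDensity m := by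
  have hl0 : 0 < Real.log N := by
    by_contra hcon
    have : Real.log N = 0 := le_antisymm (not_lt.1 hcon) (Real.log_natCast_nonneg N)
    rw [this] at hL
    norm_num at hL
  have hm0 : 0 < m := by
    rcases Nat.eq_zero_or_pos m with rfl | h
    · omega
    · exact h
  have hm0' : (0 : ℝ) < m := by exact_mod_cast hm0
  have h1 : Real.log N ≤ 2 * Real.log m := by
    have : (N : ℝ) ≤ (m : ℝ) ^ 2 := by rw [sq]; exact_mod_cast hNm
    have h2 := Real.log_le_log (by exact_mod_cast (by omega : 0 < N)) this
    rwa [Real.log_pow] at h2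
  have h2 : Real.log m ≤ Real.log N := Real.log_le_log hm0' (by exact_mod_cast hm.le)
  have hlm : 0 < Real.log m := by linarith
  have h3 : Real.log (Real.log N) / 2 ≤ Real.log (Real.log m) := by
    have h4 := Real.log_le_log hl0 h1
    rw [Real.log_mul two_ne_zero hlm.ne'] at h4
    have := Real.log_two_lt_d9
    linarith
  refine div_le_div₀ (pow_nonneg (by linarith) 3) (pow_le_pow_left₀ (by linarith) h3 3)
    (Real.sqrt_pos.2 hlm) (Real.sqrt_le_sqrt h2)

open Classical in
/-- The sums of two squares `m ∈ [√N, N)` having an overfull dyadic window. -/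
def badSet (N : ℕ) : Finset ℕ :=
  (Finset.range N).filter (fun m => m ∈ SOS ∧ N ≤ m * m ∧ ¬ GoodWindows m)

theorem exists_card_badSet_le : ∃ C : ℝ, 0 < C ∧ ∀ᶠ N : ℕ in atTop,
    ((badSet N).card : ℝ) ≤ C * N / (√(Real.log N) * Real.log (Real.log N)) := by
  classical
  obtain ⟨C, hC0, hC⟩ := exists_countPairs_le
  refine ⟨32 * C, by positivity, ?_⟩
  filter_upwards [eventually_log_log_le, hC, eventually_ge_atTop 2] with N ⟨hL2, hL96⟩ hN hN2
  set l := Real.log N with hl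
  set L := Real.log l with hL
  have hl0 : 0 < l := by linarith
  have hs0 : 0 < √l := Real.sqrt_pos.2 hl0
  have hss : √l * √l = l := Real.mul_self_sqrt hl0.le
  have hL0 : 0 < L := by linarith
  have hNpos : (0 : ℝ) < N := by exact_mod_cast (by omega : 0 < N)
  set J := Nat.log 2 N
  set E : ℕ → Finset ℕ := fun j => (Finset.range N).filter (fun m => m ∈ SOS ∧ N ≤ m * m ∧
    2 ^ j * (j : ℝ) ^ 2 * windowDensity m < (window m j).card)
  have hsub : badSet N ⊆ (Finset.Icc 1 J).biUnion E := by
    intro m hm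
    rw [badSet, Finset.mem_filter, Finset.mem_range] at hm
    obtain ⟨hm1, hm2, hm3, hm4⟩ := hm
    rw [GoodWindows] at hm4
    push Not at hm4
    obtain ⟨j, hj1, hj2, hj3⟩ := hm4
    simp only [Finset.mem_biUnion, E, Finset.mem_filter, Finset.mem_range, Finset.mem_Icc]
    exact ⟨j, ⟨hj1, Nat.le_log_of_pow_le one_lt_two (hj2.trans hm1.le)⟩, hm1, hm2, hm3, hj3⟩
  have hE : ∀ j ∈ Finset.Icc 1 J, ((E j).card : ℝ) ≤ 16 * C * N / (√l * L ^ 2) * (1 / (j : ℝ)) := by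
    intro j hj
    have hj1 := (Finset.mem_Icc.1 hj).1
    have hj0 : (0 : ℝ) < j := by exact_mod_cast hj1
    have h1 : (E j).card * (2 ^ j * (j : ℝ) ^ 2 * ((L / 2) ^ 3 / √l)) ≤
        ∑ m ∈ E j, ((window m j).card : ℝ) := by
      rw [← nsmul_eq_mul]
      refine Finset.card_nsmul_le_sum _ _ _ fun m hm => ?_
      simp only [E, Finset.mem_filter, Finset.mem_range] at hm
      refine le_trans ?_ hm.2.2.2.le
      exact mul_le_mul_of_nonneg_left (windowDensity_ge hL2 hm.1 hm.2.2.1) (by positivity)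
    have h2 : ∑ m ∈ E j, ((window m j).card : ℝ) ≤
        2 * ∑ h ∈ Finset.Ioc 0 (2 ^ j), (countPairs N h : ℝ) := by
      have h3 : ∑ m ∈ E j, (window m j).card ≤
          2 * ∑ h ∈ Finset.Ioc 0 (2 ^ j), countPairs N h := by
        refine le_trans (Finset.sum_le_sum_of_subset ?_) (sum_card_window_le N j)
        intro m hm
        simp only [E, Finset.mem_filter] at hm ⊢
        exact ⟨hm.1, hm.2.1⟩
      exact_mod_cast h3
    have h3 : ∑ h ∈ Finset.Ioc 0 (2 ^ j), (countPairs N h : ℝ) ≤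
        2 ^ j * (C * j * N * L / l) := by
      have h4 := Finset.sum_le_card_nsmul (Finset.Ioc 0 (2 ^ j)) (fun h => (countPairs N h : ℝ))
        (C * j * N * L / l) fun h hh =>
          hN j hj1 h (Finset.mem_Ioc.1 hh).1 (Finset.mem_Ioc.1 hh).2
      simpa [nsmul_eq_mul] using h4
    have h5 : (E j).card * (2 ^ j * (j : ℝ) ^ 2 * ((L / 2) ^ 3 / √l)) ≤
        2 * (2 ^ j * (C * j * N * L / l)) := by linarith
    have h6 : 0 < 2 ^ j * (j : ℝ) ^ 2 * ((L / 2) ^ 3 / √l) := by positivity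
    rw [← le_div_iff₀ h6] at h5
    refine h5.trans (le_of_eq ?_)
    generalize √l = s at hss hs0 ⊢
    rw [← hss]
    field_simp
    ring
  have hharm : ∑ j ∈ Finset.Icc 1 J, 1 / (j : ℝ) ≤ 2 * L := by
    have h1 := harmonic_le_one_add_log J
    rw [harmonic_eq_sum_Icc] at h1
    push_cast at h1
    simp only [one_div]
    refine h1.trans ?_
    have hJ1 : 1 ≤ J := Nat.le_log_of_pow_le one_lt_two (by simpa using hN2)
    have hJ0 : (0 : ℝ) < J := by exact_mod_cast hJ1
    have h2 : (J : ℝ) * Real.log 2 ≤ l := by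
      rw [← Real.log_pow]
      refine Real.log_le_log (by positivity) ?_
      exact_mod_cast Nat.pow_log_le_self 2 (by omega)
    have h3 : (J : ℝ) ≤ 2 * l := by
      have := Real.log_two_gt_d9
      nlinarith
    have h4 := Real.log_le_log hJ0 h3
    rw [Real.log_mul two_ne_zero hl0.ne'] at h4
    have := Real.log_two_lt_d9
    linarith
  calc ((badSet N).card : ℝ) ≤ ((Finset.Icc 1 J).biUnion E).card :=
        Nat.cast_le.2 (Finset.card_le_card hsub)
    _ ≤ ∑ j ∈ Finset.Icc 1 J, ((E j).card : ℝ) := by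
        exact_mod_cast Finset.card_biUnion_le
    _ ≤ ∑ j ∈ Finset.Icc 1 J, 16 * C * N / (√l * L ^ 2) * (1 / (j : ℝ)) := Finset.sum_le_sum hE
    _ = 16 * C * N / (√l * L ^ 2) * ∑ j ∈ Finset.Icc 1 J, 1 / (j : ℝ) := by rw [Finset.mul_sum]
    _ ≤ 16 * C * N / (√l * L ^ 2) * (2 * L) :=
        mul_le_mul_of_nonneg_left hharm (by positivity)
    _ = 32 * C * N / (√l * L) := by field_simp; ring

theorem natCard_subtype_eq_card (P : ℕ → Prop) [DecidablePred P] (x : ℕ) :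
    Nat.card {m : ℕ // P m ∧ m ≤ x} = ((Finset.range (x + 1)).filter P).card := by
  refine Nat.subtype_card _ fun m => ?_
  simp only [Finset.mem_filter, Finset.mem_range, Nat.lt_succ_iff]
  exact and_comm

open Classical in
theorem fullDensityIn_of_tendsto {S : Set ℕ} (hS : S ⊆ SOS) {f : ℕ → ℝ}
    (hf : Tendsto f atTop (𝓝 0)) (h : ∀ᶠ x : ℕ in atTop,
      ((((Finset.range (x + 1)).filter (fun m => m ∈ SOS ∧ m ∉ S)).card : ℕ) : ℝ) ≤
        f x * countSOS x) : FullDensityIn S := by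
  refine ⟨hS, ?_⟩
  simp only [natCard_subtype_eq_card]
  have hf' : Tendsto (fun x => 1 - f x) atTop (𝓝 1) := by simpa using hf.const_sub 1
  refine tendsto_of_tendsto_of_tendsto_of_le_of_le' hf' tendsto_const_nhds ?_ ?_
  · filter_upwards [h, eventually_ge_atTop 1] with x hx hx1
    have hle : countSOS x ≤ ((Finset.range (x + 1)).filter (· ∈ SOS)).card := by
      refine Finset.card_le_card fun m hm => ?_
      simp only [Finset.mem_filter, Finset.mem_range, Finset.mem_Ioc] at hm ⊢
      exact ⟨by omega, hm.2⟩
    have hpos : 0 < countSOS x := Finset.card_pos.2 ⟨1, by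
      simp only [Finset.mem_filter, Finset.mem_Ioc]
      exact ⟨⟨one_pos, hx1⟩, one_mem_SOS⟩⟩
    have hsplit : ((Finset.range (x + 1)).filter (· ∈ SOS)).card =
        ((Finset.range (x + 1)).filter (· ∈ S)).card +
        ((Finset.range (x + 1)).filter (fun m => m ∈ SOS ∧ m ∉ S)).card := by
      rw [← Finset.card_filter_add_card_filter_not (s := (Finset.range (x + 1)).filter (· ∈ SOS))
        (· ∈ S), Finset.filter_filter, Finset.filter_filter]
      congr 2
      refine Finset.filter_congr fun m _ => ?_
      exact ⟨fun h => h.2, fun h => ⟨hS h, h⟩⟩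
    have hle' : (countSOS x : ℝ) ≤ ((Finset.range (x + 1)).filter (· ∈ SOS)).card :=
      Nat.cast_le.2 hle
    have hpos' : (0 : ℝ) < countSOS x := by exact_mod_cast hpos
    have hsplit' : (((Finset.range (x + 1)).filter (· ∈ SOS)).card : ℝ) =
        ((Finset.range (x + 1)).filter (· ∈ S)).card +
        ((Finset.range (x + 1)).filter (fun m => m ∈ SOS ∧ m ∉ S)).card := by
      exact_mod_cast hsplit
    have hf0 : 0 ≤ f x := nonneg_of_mul_nonneg_left ((Nat.cast_nonneg _).trans hx) hpos'
    rw [le_div_iff₀ (by linarith)]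
    have := mul_le_mul_of_nonneg_left hle' hf0
    linarith
  · refine Eventually.of_forall fun x => ?_
    refine div_le_one_of_le₀ (Nat.cast_le.2 (Finset.card_le_card fun m hm => ?_))
      (Nat.cast_nonneg _)
    simp only [Finset.mem_filter] at hm ⊢
    exact ⟨hm.1, hS hm.2⟩

theorem fullDensityIn_goodWindows (M : ℕ) :
    FullDensityIn {m | m ∈ SOS ∧ M ≤ m ∧ GoodWindows m} := by
  classical
  obtain ⟨T, hT⟩ : ∃ T : Set ℕ, T = {m | m ∈ SOS ∧ M ≤ m ∧ GoodWindows m} := ⟨_, rfl⟩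
  rw [← hT]
  obtain ⟨C, hC0, hC⟩ := exists_card_badSet_le
  obtain ⟨c, hc0, X₀, hc⟩ := exists_le_countSOS
  have hC' := (tendsto_add_atTop_nat 1).eventually hC
  have hlim1 : Tendsto (fun N : ℕ => √(Real.log N / N)) atTop (𝓝 0) := by
    have h1 : Tendsto (fun x : ℝ => Real.log x / x) atTop (𝓝 0) :=
      Real.isLittleO_log_id_atTop.tendsto_div_nhds_zero
    have h2 := (h1.comp tendsto_natCast_atTop_atTop).sqrt
    simpa using h2
  have hlim2 : Tendsto (fun N : ℕ => 1 / Real.log (Real.log N)) atTop (𝓝 0) := by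
    simp only [one_div]
    exact tendsto_log_log_natCast.inv_tendsto_atTop
  have hlim : Tendsto (fun N : ℕ => 2 / c * (2 * √(Real.log N / N) +
      C * (1 / Real.log (Real.log N)))) atTop (𝓝 0) := by
    simpa using ((hlim1.const_mul 2).add (hlim2.const_mul C)).const_mul (2 / c)
  refine fullDensityIn_of_tendsto (fun m hm => (hT ▸ hm).1)
    (hlim.comp (tendsto_add_atTop_nat 1)) ?_
  filter_upwards [hC', (tendsto_add_atTop_nat 1).eventually eventually_log_log_le,
    eventually_ge_atTop X₀, eventually_ge_atTop (M * M), eventually_ge_atTop 3]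
    with x hbad ⟨hL2, hL96⟩ hx0 hxM hx3
  have hcount := hc x hx0
  simp only [Function.comp]
  set N := x + 1 with hN
  set l := Real.log N with hl
  set L := Real.log l with hL
  have hl0 : 0 < l := by linarith
  have hs0 : 0 < √l := Real.sqrt_pos.2 hl0
  have hNpos : (0 : ℝ) < N := by exact_mod_cast (by omega : 0 < N)
  have hsub : (Finset.range N).filter
      (fun m => m ∈ SOS ∧ m ∉ T) ⊆
      Finset.range (Nat.sqrt N + 1) ∪ badSet N := by
    intro m hm
    simp only [Finset.mem_filter, Finset.mem_range, hT, Set.mem_ofPred_eq, not_and] at hm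
    simp only [Finset.mem_union, Finset.mem_range, badSet, Finset.mem_filter]
    by_cases hmN : N ≤ m * m
    · right
      refine ⟨hm.1, hm.2.1, hmN, hm.2.2 hm.2.1 ?_⟩
      by_contra hcon
      have : m * m ≤ M * M := Nat.mul_le_mul (by omega) (by omega)
      omega
    · left
      exact Nat.lt_succ_of_le (Nat.le_sqrt.2 (by omega))
  have hcard : (((Finset.range N).filter
      (fun m => m ∈ SOS ∧ m ∉ T)).card : ℝ) ≤
      2 * √N + C * N / (√l * L) := by
    have h1 := (Finset.card_le_card hsub).trans (Finset.card_union_le _ _)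
    rw [Finset.card_range] at h1
    have h2 : (((Finset.range N).filter
      (fun m => m ∈ SOS ∧ m ∉ T)).card : ℝ) ≤
      (Nat.sqrt N + 1) + (badSet N).card := by exact_mod_cast h1
    have h3 : (Nat.sqrt N : ℝ) ≤ √N := Real.nat_sqrt_le_real_sqrt
    have h4 : 1 ≤ √(N : ℝ) := Real.one_le_sqrt.2 (by exact_mod_cast (by omega : 1 ≤ N))
    linarith
  have hcount2 : c * (N / 2) / √l ≤ countSOS x := by
    refine le_trans ?_ hcount
    have hx1 : (3 : ℝ) ≤ x := by exact_mod_cast hx3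
    have hNx : (N : ℝ) = x + 1 := by rw [hN]; push_cast; ring
    refine div_le_div₀ (by positivity) (mul_le_mul_of_nonneg_left (by linarith) hc0.le)
      (Real.sqrt_pos.2 (Real.log_pos (by linarith))) (Real.sqrt_le_sqrt ?_)
    exact Real.log_le_log (by linarith) (by linarith)
  have hf0 : 0 ≤ 2 / c * (2 * √(l / N) + C * (1 / L)) := by
    have : 0 < L := by linarith
    positivity
  refine hcard.trans (le_trans (le_of_eq ?_) (mul_le_mul_of_nonneg_left hcount2 hf0))
  have hL0 : L ≠ 0 := by linarith
  have hsN : √(N : ℝ) * √N = N := Real.mul_self_sqrt hNpos.le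
  have hsN0 : 0 < √(N : ℝ) := Real.sqrt_pos.2 hNpos
  rw [Real.sqrt_div hl0.le]
  generalize √(N : ℝ) = r at hsN hsN0 ⊢
  generalize √l = t at hs0 ⊢
  rw [← hsN]
  field_simp

theorem exists_card_window_le_of_lt : ∃ C : ℝ, 0 < C ∧ ∀ᶠ m : ℕ in atTop, ∀ j : ℕ, m < 2 ^ j →
    ((window m j).card : ℝ) ≤ C * (2 ^ j * (j : ℝ) ^ 2 * windowDensity m) := by
  obtain ⟨C, hC0, hC⟩ := exists_countPairs_zero_le
  obtain ⟨X₁, hX₁⟩ := eventually_atTop.1 hC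
  refine ⟨2 * C, by positivity, ?_⟩
  filter_upwards [eventually_log_log_le, eventually_ge_atTop X₁, eventually_ge_atTop 2]
    with m ⟨hL2, hL96⟩ hm hm2 j hj
  have hj1 : 1 ≤ j := by
    rcases Nat.eq_zero_or_pos j with rfl | h
    · simp at hj; omega
    · exact h
  have hj1' : (1 : ℝ) ≤ j := by exact_mod_cast hj1
  have hpow : 2 ^ (j + 1) = 2 ^ j + 2 ^ j := by ring
  have h1 : (window m j).card ≤ countPairs (2 ^ (j + 1)) 0 := by
    refine Finset.card_le_card fun n hn => ?_
    obtain ⟨h1, -, -, h4⟩ := mem_window.1 hn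
    simp only [Finset.mem_filter, Finset.mem_range, add_zero]
    exact ⟨by omega, h1, h1⟩
  have h2 := hX₁ (2 ^ (j + 1)) (by omega)
  have hlm : 0 < Real.log m := by linarith
  have hm0 : (0 : ℝ) < m := by exact_mod_cast (by omega : 0 < m)
  have h3 : Real.log m ≤ Real.log (2 ^ (j + 1) : ℕ) :=
    Real.log_le_log hm0 (by exact_mod_cast (by omega : m ≤ 2 ^ (j + 1)))
  have h4 : Real.log (Real.log (2 ^ (j + 1) : ℕ)) ≤ (j : ℝ) ^ 2 := by
    have h5 : Real.log (2 ^ (j + 1) : ℕ) ≤ j + 1 := by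
      push_cast
      rw [Real.log_pow]
      have : Real.log 2 ≤ 1 := by have := Real.log_two_lt_d9; linarith
      push_cast
      exact mul_le_of_le_one_right (by linarith) this
    have h6 := Real.log_le_sub_one_of_pos (hlm.trans_le h3)
    nlinarith
  have h5 : C * (2 ^ (j + 1) : ℕ) * Real.log (Real.log (2 ^ (j + 1) : ℕ)) /
      √(Real.log (2 ^ (j + 1) : ℕ)) ≤ C * (2 ^ (j + 1) : ℕ) * (j : ℝ) ^ 2 / √(Real.log m) :=
    div_le_div₀ (by positivity) (mul_le_mul_of_nonneg_left h4 (by positivity))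
      (Real.sqrt_pos.2 hlm) (Real.sqrt_le_sqrt h3)
  have h6 : 1 / √(Real.log m) ≤ windowDensity m := by
    refine div_le_div_of_nonneg_right ?_ (Real.sqrt_nonneg _)
    exact one_le_pow₀ (by linarith)
  have h7 : ((window m j).card : ℝ) ≤ countPairs (2 ^ (j + 1)) 0 := Nat.cast_le.2 h1
  calc ((window m j).card : ℝ) ≤ _ := h7.trans (h2.trans h5)
    _ = 2 * C * (2 ^ j * (j : ℝ) ^ 2) * (1 / √(Real.log m)) := by push_cast; ring
    _ ≤ 2 * C * (2 ^ j * (j : ℝ) ^ 2) * windowDensity m :=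
        mul_le_mul_of_nonneg_left h6 (by positivity)
    _ = _ := by ring

theorem exists_card_window_le_of_goodWindows : ∃ C : ℝ, 0 < C ∧ ∀ᶠ m : ℕ in atTop,
    GoodWindows m → ∀ j : ℕ, 1 ≤ j →
    ((window m j).card : ℝ) ≤ 2 ^ j * (j : ℝ) ^ 2 * (C * windowDensity m) := by
  obtain ⟨C, hC0, hC⟩ := exists_card_window_le_of_lt
  refine ⟨C + 1, by positivity, ?_⟩
  filter_upwards [hC, eventually_log_log_le] with m hm ⟨hL2, hL96⟩ hgood j hj
  have hw : 0 ≤ windowDensity m := div_nonneg (pow_nonneg (by linarith) 3) (Real.sqrt_nonneg _)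
  have hT : 0 ≤ 2 ^ j * (j : ℝ) ^ 2 * windowDensity m := by positivity
  have hCT : 0 ≤ C * (2 ^ j * (j : ℝ) ^ 2 * windowDensity m) := by positivity
  rcases le_or_gt (2 ^ j) m with h | h
  · have := hgood j hj h
    linarith
  · have := hm j h
    linarith

theorem summable_add_two_sq_mul_pow {θ : ℝ} (h0 : 0 ≤ θ) (h1 : θ < 1) :
    Summable (fun i : ℕ => ((i : ℝ) + 2) ^ 2 * θ ^ i) := by
  have hn : ‖θ‖ < 1 := by rwa [Real.norm_of_nonneg h0]
  have := ((summable_pow_mul_geometric_of_norm_lt_one 2 hn).add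
    ((summable_pow_mul_geometric_of_norm_lt_one 1 hn).mul_left 4)).add
    ((summable_pow_mul_geometric_of_norm_lt_one 0 hn).mul_left 4)
  refine this.congr fun i => ?_
  ring

theorem exists_sum_rpow_le {q : ℝ} (hq : 1 / 2 < q) : ∃ A : ℝ, 0 < A ∧ ∀ (m : ℕ) (B G : ℝ),
    0 ≤ B → 2 ≤ G →
    (∀ j : ℕ, 1 ≤ j → ((window m j).card : ℝ) ≤ 2 ^ j * (j : ℝ) ^ 2 * B) →
    ∀ v : Finset ℕ, (∀ n ∈ v, n ∈ SOS ∧ G ≤ |(m : ℝ) - n|) →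
    ∑ n ∈ v, |(m : ℝ) - n| ^ (-(2 * q)) ≤ A * (Real.log G ^ 2 * G ^ (1 - 2 * q)) * B := by
  classical
  set θ : ℝ := 2 ^ (1 - 2 * q) with hθ
  have hθ0 : 0 < θ := Real.rpow_pos_of_pos two_pos _
  have hθ1 : θ < 1 := Real.rpow_lt_one_of_one_lt_of_neg one_lt_two (by linarith)
  have hsum := summable_add_two_sq_mul_pow hθ0.le hθ1
  set T := ∑' i : ℕ, ((i : ℝ) + 2) ^ 2 * θ ^ i with hT
  have hT0 : 0 < T := hsum.tsum_pos (fun i => by positivity) 0 (by norm_num)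
  refine ⟨8 * T * (1 / θ), by positivity, ?_⟩
  intro m B G hB hG hwin v hv
  set d : ℕ → ℕ := fun n => ((m : ℤ) - n).natAbs with hd
  have hdabs : ∀ n : ℕ, |(m : ℝ) - n| = d n := by
    intro n
    simp only [hd, Nat.cast_natAbs]
    push_cast
    rfl
  set k := Nat.log 2 ⌊G⌋₊
  have hfl2 : 2 ≤ ⌊G⌋₊ := Nat.le_floor (by exact_mod_cast hG)
  have hk1 : 1 ≤ k := Nat.le_log_of_pow_le one_lt_two (by simpa using hfl2)
  have hk1' : (1 : ℝ) ≤ k := by exact_mod_cast hk1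
  have hkG : (2 : ℝ) ^ k ≤ G := by
    have h1 : 2 ^ k ≤ ⌊G⌋₊ := Nat.pow_log_le_self 2 (by omega)
    have h2 : ((2 ^ k : ℕ) : ℝ) ≤ ⌊G⌋₊ := Nat.cast_le.2 h1
    push_cast at h2
    exact h2.trans (Nat.floor_le (by linarith))
  have hGk : G ≤ 2 * 2 ^ k := by
    have h1 : ⌊G⌋₊ < 2 ^ (k + 1) := Nat.lt_pow_succ_log_self one_lt_two _
    have h2 : G < (2 ^ (k + 1) : ℕ) := (Nat.floor_lt (by linarith)).1 h1
    push_cast at h2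
    rw [pow_succ] at h2
    linarith
  have hdk : ∀ n ∈ v, 2 ^ k ≤ d n := by
    intro n hn
    have h1 := hkG.trans (hv n hn).2
    rw [hdabs] at h1
    exact_mod_cast h1
  have hlogd : ∀ n ∈ v, k ≤ Nat.log 2 (d n) := fun n hn =>
    Nat.le_log_of_pow_le one_lt_two (hdk n hn)
  set K := v.sup (fun n => Nat.log 2 (d n)) + 1
  have hmaps : ∀ n ∈ v, Nat.log 2 (d n) - k ∈ Finset.range K := by
    intro n hn
    have : Nat.log 2 (d n) ≤ v.sup (fun n => Nat.log 2 (d n)) :=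
      Finset.le_sup (f := fun n => Nat.log 2 (d n)) hn
    rw [Finset.mem_range]
    omega
  rw [← Finset.sum_fiberwise_of_maps_to hmaps]
  have hshell : ∀ i ∈ Finset.range K,
      ∑ n ∈ v.filter (fun n => Nat.log 2 (d n) - k = i), |(m : ℝ) - n| ^ (-(2 * q)) ≤
      2 * B * (k : ℝ) ^ 2 * θ ^ k * (((i : ℝ) + 2) ^ 2 * θ ^ i) := by
    intro i _
    have hmem : ∀ n ∈ v.filter (fun n => Nat.log 2 (d n) - k = i),
        2 ^ (k + i) ≤ d n ∧ d n < 2 ^ (k + i + 1) := by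
      intro n hn
      obtain ⟨hnv, hni⟩ := Finset.mem_filter.1 hn
      have h1 := hlogd n hnv
      have h2 : Nat.log 2 (d n) = k + i := by omega
      have h3 : d n ≠ 0 := by
        have := hdk n hnv
        have := Nat.two_pow_pos k
        omega
      exact ⟨h2 ▸ Nat.pow_log_le_self 2 h3, h2 ▸ Nat.lt_pow_succ_log_self one_lt_two _⟩
    have hsub : v.filter (fun n => Nat.log 2 (d n) - k = i) ⊆ window m (k + i + 1) := by
      intro n hn
      obtain ⟨h1, h2⟩ := hmem n hn
      have h3 := Nat.two_pow_pos (k + i)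
      refine mem_window.2 ⟨(hv n (Finset.mem_filter.1 hn).1).1, ?_, ?_, ?_⟩
      all_goals simp only [hd] at h1 h2; omega
    have hterm : ∀ n ∈ v.filter (fun n => Nat.log 2 (d n) - k = i),
        |(m : ℝ) - n| ^ (-(2 * q)) ≤ ((2 : ℝ) ^ (k + i)) ^ (-(2 * q)) := by
      intro n hn
      rw [hdabs]
      refine Real.rpow_le_rpow_of_nonpos (by positivity) ?_ (by linarith)
      exact_mod_cast (hmem n hn).1
    have hcard : ((v.filter (fun n => Nat.log 2 (d n) - k = i)).card : ℝ) ≤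
        2 ^ (k + i + 1) * ((k + i + 1 : ℕ) : ℝ) ^ 2 * B :=
      (Nat.cast_le.2 (Finset.card_le_card hsub)).trans (hwin (k + i + 1) (by omega))
    have hpow : (2 : ℝ) ^ (k + i) * ((2 : ℝ) ^ (k + i)) ^ (-(2 * q)) = θ ^ (k + i) := by
      rw [hθ, ← Real.rpow_natCast (2 ^ (1 - 2 * q)), ← Real.rpow_mul two_pos.le,
        ← Real.rpow_natCast 2, ← Real.rpow_mul two_pos.le, ← Real.rpow_add two_pos]
      ring_nf
    have hki : ((k + i + 1 : ℕ) : ℝ) ≤ k * (i + 2) := by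
      push_cast
      have : (0 : ℝ) ≤ i := Nat.cast_nonneg i
      nlinarith
    have hki2 : ((k + i + 1 : ℕ) : ℝ) ^ 2 ≤ (k * (i + 2)) ^ 2 :=
      pow_le_pow_left₀ (Nat.cast_nonneg _) hki 2
    calc _ ≤ ((v.filter (fun n => Nat.log 2 (d n) - k = i)).card : ℝ) *
          ((2 : ℝ) ^ (k + i)) ^ (-(2 * q)) := by
          rw [← nsmul_eq_mul]
          exact Finset.sum_le_card_nsmul _ _ _ hterm
      _ ≤ 2 ^ (k + i + 1) * ((k + i + 1 : ℕ) : ℝ) ^ 2 * B *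
          ((2 : ℝ) ^ (k + i)) ^ (-(2 * q)) := mul_le_mul_of_nonneg_right hcard (by positivity)
      _ = 2 * B * ((k + i + 1 : ℕ) : ℝ) ^ 2 *
          ((2 : ℝ) ^ (k + i) * ((2 : ℝ) ^ (k + i)) ^ (-(2 * q))) := by ring
      _ = 2 * B * ((k + i + 1 : ℕ) : ℝ) ^ 2 * θ ^ (k + i) := by rw [hpow]
      _ ≤ 2 * B * (k * (i + 2)) ^ 2 * θ ^ (k + i) := by gcongr
      _ = _ := by ring
  have hklog : (k : ℝ) ^ 2 ≤ 4 * Real.log G ^ 2 := by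
    have h1 : (k : ℝ) * Real.log 2 ≤ Real.log G := by
      rw [← Real.log_pow]
      exact Real.log_le_log (by positivity) hkG
    have h2 : (k : ℝ) ≤ 2 * Real.log G := by
      have := Real.log_two_gt_d9
      nlinarith
    nlinarith
  have hθk : θ ^ k ≤ G ^ (1 - 2 * q) * (1 / θ) := by
    have h1 : θ ^ (k + 1) ≤ G ^ (1 - 2 * q) := by
      rw [hθ, ← Real.rpow_natCast (2 ^ (1 - 2 * q)), ← Real.rpow_mul two_pos.le,
        mul_comm (1 - 2 * q), Real.rpow_mul two_pos.le, Real.rpow_natCast]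
      refine Real.rpow_le_rpow_of_nonpos (by linarith) ?_ (by linarith)
      rw [pow_succ]
      linarith
    rw [mul_one_div, le_div_iff₀ hθ0, ← pow_succ]
    exact h1
  calc _ ≤ ∑ i ∈ Finset.range K, 2 * B * (k : ℝ) ^ 2 * θ ^ k * (((i : ℝ) + 2) ^ 2 * θ ^ i) :=
        Finset.sum_le_sum hshell
    _ = 2 * B * (k : ℝ) ^ 2 * θ ^ k * ∑ i ∈ Finset.range K, ((i : ℝ) + 2) ^ 2 * θ ^ i := by
        rw [Finset.mul_sum]
    _ ≤ 2 * B * (k : ℝ) ^ 2 * θ ^ k * T := by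
        refine mul_le_mul_of_nonneg_left ?_ (by positivity)
        exact hsum.sum_le_tsum _ fun i _ => by positivity
    _ = 2 * B * T * ((k : ℝ) ^ 2 * θ ^ k) := by ring
    _ ≤ 2 * B * T * (4 * Real.log G ^ 2 * (G ^ (1 - 2 * q) * (1 / θ))) := by
        refine mul_le_mul_of_nonneg_left ?_ (by positivity)
        exact mul_le_mul hklog hθk (by positivity) (by positivity)
    _ = _ := by ring

theorem tendsto_log_mul_cube_div {A : ℝ} (hA : 0 < A) :
    Tendsto (fun L : ℝ => Real.log (A * L ^ 3) / L) atTop (𝓝 0) := by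
  have h1 : Tendsto (fun x : ℝ => Real.log x / x) atTop (𝓝 0) :=
    Real.isLittleO_log_id_atTop.tendsto_div_nhds_zero
  have h2 : Tendsto (fun x : ℝ => Real.log A / x) atTop (𝓝 0) :=
    tendsto_const_nhds.div_atTop tendsto_id
  have h3 : Tendsto (fun x : ℝ => Real.log A / x + 3 * (Real.log x / x)) atTop (𝓝 0) := by
    simpa using h2.add (h1.const_mul 3)
  refine h3.congr' ?_
  filter_upwards [eventually_gt_atTop 0] with x hx
  rw [Real.log_mul hA.ne' (by positivity), Real.log_pow]
  push_cast
  ring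

/-- For `m` in a full density subset of `𝒩` and all `2 ≤ G ≤ m^{1−ε}`,
`∑_{n ∈ 𝒩, |m − n| ≥ G} |m − n|^{−2q} ≤ (log G)² G^{1−2q} (log m)^{−1/2 + o(1)}`. -/
theorem unweighted_tail_bound (q ε : ℝ) (hq : 1 / 2 < q) (hε : ε ∈ Set.Ioo (0 : ℝ) 1) :
    ∃ (S : Set ℕ) (δ : ℕ → ℝ), FullDensityIn S ∧
      Tendsto δ (atTop ⊓ 𝓟 S) (𝓝 0) ∧
      ∀ m ∈ S, ∀ G : ℝ, 2 ≤ G → G ≤ (m : ℝ) ^ (1 - ε) →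
        (∑' n : {n : ℕ // n ∈ SOS ∧ G ≤ |(m : ℝ) - ((n : ℕ) : ℝ)|},
            |(m : ℝ) - ((n : ℕ) : ℝ)| ^ (-(2 * q)))
          ≤ Real.log G ^ 2 * G ^ (1 - 2 * q) * Real.log m ^ (-(1 / 2) + δ m) := by
  obtain ⟨C, hC0, hC⟩ := exists_card_window_le_of_goodWindows
  obtain ⟨A, hA0, hA⟩ := exists_sum_rpow_le hq
  obtain ⟨M, hM⟩ := eventually_atTop.1 (hC.and eventually_log_log_le)
  refine ⟨{m | m ∈ SOS ∧ M ≤ m ∧ GoodWindows m},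
    fun m => Real.log (A * C * Real.log (Real.log m) ^ 3) / Real.log (Real.log m),
    fullDensityIn_goodWindows M,
    ((tendsto_log_mul_cube_div (mul_pos hA0 hC0)).comp tendsto_log_log_natCast).mono_left
      inf_le_left, ?_⟩
  rintro m ⟨-, hmM, hgood⟩ G hG -
  obtain ⟨hwin, hL2, hL96⟩ := hM m hmM
  set L := Real.log (Real.log m) with hL
  have hl : 0 < Real.log m := by linarith
  have hL0 : 0 < L := by linarith
  have hexp : Real.exp L = Real.log m := Real.exp_log hl
  have hB : 0 ≤ C * windowDensity m :=
    mul_nonneg hC0.le (div_nonneg (pow_nonneg hL0.le 3) (Real.sqrt_nonneg _))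
  have hpow : Real.log m ^ (-(1 / 2) + Real.log (A * C * L ^ 3) / L) =
      A * (C * windowDensity m) := by
    rw [Real.rpow_add hl, Real.rpow_neg hl.le, ← Real.sqrt_eq_rpow, windowDensity, ← hL,
      Real.rpow_def_of_pos hl, ← hL, mul_div_cancel₀ _ hL0.ne', Real.exp_log (by positivity)]
    ring
  rw [hpow]
  refine Real.tsum_le_of_sum_le (fun n => Real.rpow_nonneg (abs_nonneg _) _) fun u => ?_
  have h1 := hA m _ G hB hG (hwin hgood) (u.map (Function.Embedding.subtype _)) (by
    intro n hn
    obtain ⟨a, -, rfl⟩ := Finset.mem_map.1 hn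
    exact a.2)
  rw [Finset.sum_map] at h1
  calc _ ≤ _ := h1
    _ = _ := by ring
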